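/- Let (W,S) be a finite irreducible Coxeter system of rank n with Coxeter number h, let E(W) be the number of edges of the Hasse diagram of the noncrossing partition lattice L_W, i.e., the number of pairs (x,y) with x, y ∈ L_W, x ≤ y in absolute order, and ℓ_T(y) = ℓ_T(x) + 1, and let NC(V) denote the number of elements of the noncrossing partition lattice of a finite Coxeter system V. Then 2·E(W) = h · ∑_{s∈S} NC(W_⟨s⟩). -/

import Mathlib

open scoped BigOperators

section Defs

variable {G : Type*} [Group G]

/-- `t` is a reflection with respect to the generating set `S`:
a conjugate of an element of `S`. -/
def IsReflectionOf (S : Set G) (t : G) : Prop :=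
  ∃ g : G, ∃ s ∈ S, t = g * s * g⁻¹

/-- The absolute length of `w`: the minimal length of a word in the
reflections (conjugates of elements of `S`) whose product is `w`. -/
noncomputable def absLength (S : Set G) (w : G) : ℕ :=
  sInf {k | ∃ l : List G, (∀ t ∈ l, IsReflectionOf S t) ∧ l.length = k ∧ l.prod = w}

/-- The absolute order: `u ≤ v` iff `ℓ_T(u) + ℓ_T(u⁻¹v) = ℓ_T(v)`. -/
def absLe (S : Set G) (u v : G) : Prop :=
  absLength S u + absLength S (u⁻¹ * v) = absLength S v

/-- `c` is a Coxeter element with respect to the set `S` of simple reflections: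
a product of all the elements of `S`, each occurring exactly once, in some order. -/
def IsCoxeterElementOf (S : Set G) (c : G) : Prop :=
  ∃ l : List G, l.Nodup ∧ (∀ x, x ∈ l ↔ x ∈ S) ∧ l.prod = c

/-- The rank-selected multichain count `C_{(j₁,…,j_m)}(W)`: the number of multichains
`x₁ ≤ ⋯ ≤ x_{m-1}` in the interval `[1,c]` of the absolute order whose sequence of
rank jumps (prepending `1` and appending `c`) is given by `j`. -/
noncomputable def chainCount (S : Set G) (c : G) {m : ℕ} (j : Fin m → ℕ) : ℕ :=
  Nat.card {y : Fin (m + 1) → G //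
    y 0 = 1 ∧ y (Fin.last m) = c ∧
    (∀ i, absLe S (y i) c) ∧
    (∀ i : Fin m, absLe S (y i.castSucc) (y i.succ)) ∧
    (∀ i : Fin m, absLength S (y i.succ) = absLength S (y i.castSucc) + j i)}

end Defs

section Cox

variable {B : Type*} {W : Type*} [Group W] {M : CoxeterMatrix B}

/-- The set of simple reflections of a Coxeter system. -/
def simpleSet (cs : CoxeterSystem M W) : Set W := Set.range cs.simple

/-- A Coxeter system is irreducible if its set of simple reflections is nonempty and cannot
be partitioned into two nonempty subsets such that every simple reflection in one commutes
with every simple reflection in the other. -/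
def IsIrreducibleCS (cs : CoxeterSystem M W) : Prop :=
  Nonempty B ∧
    ∀ A : Set B, (∀ a ∈ A, ∀ b ∈ Aᶜ, Commute (cs.simple a) (cs.simple b)) →
      A = ∅ ∨ A = Set.univ

/-- The standard parabolic subgroup `W_⟨s⟩` generated by the simple reflections
other than `cs.simple s`. -/
def parabolic (cs : CoxeterSystem M W) (s : B) : Subgroup W :=
  Subgroup.closure (Set.range cs.simple \ {cs.simple s})

/-- The set of simple reflections of the parabolic subgroup `W_⟨s⟩`, viewed as
elements of that subgroup. -/
def parabolicGens (cs : CoxeterSystem M W) (s : B) : Set (parabolic cs s) :=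
  {x | (x : W) ∈ Set.range cs.simple \ {cs.simple s}}

end Cox

section MoreCounts

variable {G : Type*} [Group G]

/-- `TW_k(W)`: the number of chains `1 = x₀ < x₁ < ⋯ < x_k` in the noncrossing partition
lattice `[1,c]` with `ℓ_T(xᵢ) = i` for all `i` (equivalently, the number of reduced
`T`-words of elements of absolute length `k` in `[1,c]`). -/
noncomputable def twCount (S : Set G) (c : G) (k : ℕ) : ℕ :=
  Nat.card {y : Fin (k + 1) → G //
    y 0 = 1 ∧ (∀ i, absLe S (y i) c) ∧
    (∀ i : Fin k, absLe S (y i.castSucc) (y i.succ)) ∧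
    (∀ i : Fin (k + 1), absLength S (y i) = (i : ℕ))}

/-- `NC(W)`: the number of elements of the noncrossing partition lattice `[1,c]`. -/
noncomputable def ncCount (S : Set G) (c : G) : ℕ :=
  Nat.card {w : G // absLe S w c}

/-- `E(W)`: the number of edges of the Hasse diagram of the noncrossing partition lattice
`[1,c]`, i.e. pairs `(x,y)` with `x ≤ y` in `[1,c]` and `ℓ_T(y) = ℓ_T(x) + 1`. -/
noncomputable def edgeCount (S : Set G) (c : G) : ℕ :=
  Nat.card {p : G × G // absLe S p.1 c ∧ absLe S p.2 c ∧ absLe S p.1 p.2 ∧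
    absLength S p.2 = absLength S p.1 + 1}

/-- `SC_k(W)`: the number of saturated chains `x₀ < x₁ < ⋯ < x_k` of length `k` in the
noncrossing partition lattice `[1,c]`, i.e. with `ℓ_T(xᵢ) = ℓ_T(x₀) + i` for all `i`. -/
noncomputable def scCount (S : Set G) (c : G) (k : ℕ) : ℕ :=
  Nat.card {y : Fin (k + 1) → G //
    (∀ i, absLe S (y i) c) ∧
    (∀ i : Fin k, absLe S (y i.castSucc) (y i.succ)) ∧
    (∀ i : Fin k, absLength S (y i.succ) = absLength S (y i.castSucc) + 1)}

end MoreCounts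

set_option linter.unusedSectionVars false

namespace CoxeterMatrix

theorem sin_pi_div_pos {B : Type*} (M : CoxeterMatrix B) {i j : B} (hij : i ≠ j) (h0 : M i j ≠ 0) :
    0 < Real.sin (Real.pi / M i j) := by
  have h1 := M.off_diagonal i j hij
  have h2 : (2 : ℝ) ≤ M i j := by
    exact_mod_cast (show 2 ≤ M i j by omega)
  apply Real.sin_pos_of_pos_of_lt_pi
  · have := Real.pi_pos
    positivity
  · rw [div_lt_iff₀ (by linarith)]
    nlinarith [Real.pi_pos]

variable {B : Type*} [Fintype B] [DecidableEq B] (M : CoxeterMatrix B)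

/-- The simple root `α i`, a basis vector of the geometric representation. -/
def simpleRoot {B : Type*} [DecidableEq B] (i : B) : B → ℝ := Pi.single i 1

/-- The bilinear form of the geometric representation. -/
noncomputable def cosForm : LinearMap.BilinForm ℝ (B → ℝ) :=
  Matrix.toBilin' (Matrix.of fun i j => -Real.cos (Real.pi / M i j))

theorem cosForm_simpleRoot (i j : B) :
    M.cosForm (simpleRoot i) (simpleRoot j) = -Real.cos (Real.pi / M i j) := by
  simp [cosForm, simpleRoot, Matrix.toBilin'_single]

theorem cosForm_comm (x y : B → ℝ) : M.cosForm x y = M.cosForm y x := by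
  simp only [cosForm, Matrix.toBilin'_apply]
  rw [Finset.sum_comm]
  refine Finset.sum_congr rfl fun i _ => Finset.sum_congr rfl fun j _ => ?_
  simp only [Matrix.of_apply, M.symmetric j i]
  ring

theorem cosForm_simpleRoot_self (i : B) : M.cosForm (simpleRoot i) (simpleRoot i) = 1 := by
  simp [cosForm_simpleRoot]

theorem eq_sum_smul_simpleRoot (x : B → ℝ) : x = ∑ i, x i • simpleRoot i :=
  pi_eq_sum_univ' x

/-- The map `x ↦ x - 2 ⟪x, r⟫ r`, which is the orthogonal reflection in `r` if `⟪r, r⟫ = 1`. -/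
noncomputable def rootReflection (r : B → ℝ) : Module.End ℝ (B → ℝ) :=
  LinearMap.id - (2 : ℝ) • (M.cosForm.flip r).smulRight r

theorem rootReflection_apply (r x : B → ℝ) :
    M.rootReflection r x = x - (2 * M.cosForm x r) • r := by
  simp [rootReflection, mul_smul]

theorem rootReflection_self {r : B → ℝ} (hr : M.cosForm r r = 1) :
    M.rootReflection r r = -r := by
  rw [rootReflection_apply, hr]
  module

theorem rootReflection_mul_self {r : B → ℝ} (hr : M.cosForm r r = 1) :
    M.rootReflection r * M.rootReflection r = 1 := by
  refine LinearMap.ext fun x => ?_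
  simp only [Module.End.mul_apply, rootReflection_apply, map_sub, map_smul, hr,
    Module.End.one_apply]
  module

theorem cosForm_rootReflection {r : B → ℝ} (hr : M.cosForm r r = 1) (x y : B → ℝ) :
    M.cosForm (M.rootReflection r x) (M.rootReflection r y) = M.cosForm x y := by
  simp only [rootReflection_apply, map_sub, map_smul, LinearMap.sub_apply,
    LinearMap.smul_apply, hr, smul_eq_mul, M.cosForm_comm r y]
  ring

theorem rootReflection_neg (r : B → ℝ) : M.rootReflection (-r) = M.rootReflection r := by
  refine LinearMap.ext fun x => ?_
  simp [rootReflection_apply]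

theorem rootReflection_simpleRoot_add (i j : B) (a b : ℝ) :
    M.rootReflection (simpleRoot j) (a • simpleRoot i + b • simpleRoot j) =
      a • simpleRoot i + (2 * Real.cos (Real.pi / M i j) * a - b) • simpleRoot j := by
  simp only [rootReflection_apply, map_add, map_smul, cosForm_simpleRoot_self,
    cosForm_simpleRoot]
  module

theorem rootReflection_sin (i j : B) (φ : ℝ) :
    M.rootReflection (simpleRoot j) (Real.sin (φ + Real.pi / M i j) • simpleRoot i +
        Real.sin φ • simpleRoot j) =
      Real.sin (φ + Real.pi / M i j) • simpleRoot i +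
        Real.sin (φ + 2 * (Real.pi / M i j)) • simpleRoot j := by
  rw [rootReflection_simpleRoot_add]
  congr 2
  set θ := Real.pi / M i j
  rw [two_mul θ, ← add_assoc, Real.sin_add (φ + θ) θ, Real.sin_add φ θ, Real.cos_add φ θ]
  linear_combination Real.sin φ * Real.sin_sq_add_cos_sq θ

theorem rootReflection_mul_sin (i j : B) (φ : ℝ) :
    (M.rootReflection (simpleRoot i) * M.rootReflection (simpleRoot j))
      (Real.sin (φ + Real.pi / M i j) • simpleRoot i + Real.sin φ • simpleRoot j) =
      Real.sin (φ + 2 * (Real.pi / M i j) + Real.pi / M i j) • simpleRoot i +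
        Real.sin (φ + 2 * (Real.pi / M i j)) • simpleRoot j := by
  rw [Module.End.mul_apply, rootReflection_sin, add_comm]
  have h := M.rootReflection_sin j i (φ + Real.pi / M i j)
  rw [M.symmetric j i] at h
  rw [two_mul, ← add_assoc, h, add_comm]
  congr 3
  ring

theorem rootReflection_mul_pow_sin (i j : B) (φ : ℝ) (k : ℕ) :
    ((M.rootReflection (simpleRoot i) * M.rootReflection (simpleRoot j)) ^ k)
      (Real.sin (φ + Real.pi / M i j) • simpleRoot i + Real.sin φ • simpleRoot j) =
      Real.sin (φ + k * (2 * (Real.pi / M i j)) + Real.pi / M i j) • simpleRoot i +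
        Real.sin (φ + k * (2 * (Real.pi / M i j))) • simpleRoot j := by
  induction k generalizing φ with
  | zero => simp
  | succ k ih =>
    rw [pow_succ, Module.End.mul_apply, rootReflection_mul_sin, ih]
    push_cast
    congr 3 <;> ring

theorem isLiftable_rootReflection :
    M.IsLiftable fun i => M.rootReflection (simpleRoot i) := by
  intro i j
  by_cases hij : i = j
  · subst hij
    simp [rootReflection_mul_self, cosForm_simpleRoot_self]
  by_cases h0 : M i j = 0
  · simp [h0]
  set g := M.rootReflection (simpleRoot i) * M.rootReflection (simpleRoot j) with hg
  set θ := Real.pi / M i j with hθ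
  have hs : Real.sin θ ≠ 0 := (M.sin_pi_div_pos hij h0).ne'
  have hmθ : (M i j : ℝ) * (2 * θ) = 2 * Real.pi := by
    rw [hθ]
    field_simp
  have key (φ : ℝ) : (g ^ M i j) (Real.sin (φ + θ) • simpleRoot i + Real.sin φ • simpleRoot j) =
      Real.sin (φ + θ) • simpleRoot i + Real.sin φ • simpleRoot j := by
    rw [hg, hθ, rootReflection_mul_pow_sin, ← hθ, hmθ, add_right_comm, Real.sin_add_two_pi,
      Real.sin_add_two_pi]
  have hi : (g ^ M i j) (simpleRoot i) = simpleRoot i := by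
    have := key 0
    simp only [zero_add, Real.sin_zero, zero_smul, add_zero, map_smul] at this
    exact smul_right_injective _ hs this
  have hj : (g ^ M i j) (simpleRoot j) = simpleRoot j := by
    have := key (-θ)
    simp only [neg_add_cancel, Real.sin_zero, zero_smul, zero_add, map_smul] at this
    exact smul_right_injective _ (by simpa using hs) this
  have hfix (z : B → ℝ) (h1 : M.cosForm z (simpleRoot i) = 0)
      (h2 : M.cosForm z (simpleRoot j) = 0) (k : ℕ) : (g ^ k) z = z := by
    induction k with
    | zero => simp
    | succ k ih =>
      rw [pow_succ, Module.End.mul_apply, hg, Module.End.mul_apply,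
        rootReflection_apply _ _ z, h2]
      simp only [mul_zero, zero_smul, sub_zero]
      rw [rootReflection_apply _ _ z, h1]
      simpa using ih
  refine LinearMap.ext fun z => ?_
  set zi := M.cosForm z (simpleRoot i)
  set zj := M.cosForm z (simpleRoot j)
  set a := (zi + zj * Real.cos θ) / Real.sin θ ^ 2
  set b := (zj + zi * Real.cos θ) / Real.sin θ ^ 2
  have hc : Real.cos θ ^ 2 = 1 - Real.sin θ ^ 2 := Real.cos_sq' θ
  have hz : z =
      (z - a • simpleRoot i - b • simpleRoot j) + a • simpleRoot i + b • simpleRoot j := by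
    module
  rw [hz, map_add, map_add, hfix, map_smul, map_smul, hi, hj, Module.End.one_apply]
  · simp only [map_sub, map_smul, LinearMap.sub_apply, LinearMap.smul_apply,
      cosForm_simpleRoot_self, smul_eq_mul, cosForm_simpleRoot, M.symmetric j i]
    change zi - a * 1 - b * -Real.cos θ = 0
    simp only [a, b]
    field_simp
    linear_combination zi * hc
  · simp only [map_sub, map_smul, LinearMap.sub_apply, LinearMap.smul_apply,
      cosForm_simpleRoot_self, smul_eq_mul, cosForm_simpleRoot]
    change zj - a * -Real.cos θ - b * 1 = 0
    simp only [a, b]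
    field_simp
    linear_combination zj * hc

end CoxeterMatrix

open CoxeterMatrix

namespace CoxeterSystem

variable {B : Type*} [Fintype B] [DecidableEq B] {W : Type*} [Group W] {M : CoxeterMatrix B}
  (cs : CoxeterSystem M W)

/-- The geometric representation of a Coxeter group. -/
noncomputable def geomRep : W →* Module.End ℝ (B → ℝ) :=
  cs.lift ⟨fun i => M.rootReflection (simpleRoot i), M.isLiftable_rootReflection⟩

theorem geomRep_simple (i : B) : cs.geomRep (cs.simple i) = M.rootReflection (simpleRoot i) :=
  cs.lift_apply_simple M.isLiftable_rootReflection i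

theorem geomRep_mul_apply (v w : W) (x : B → ℝ) :
    cs.geomRep (v * w) x = cs.geomRep v (cs.geomRep w x) := by
  rw [map_mul, Module.End.mul_apply]

@[simp]
theorem geomRep_inv_apply_self (w : W) (x : B → ℝ) : cs.geomRep w⁻¹ (cs.geomRep w x) = x := by
  rw [← geomRep_mul_apply, inv_mul_cancel, map_one, Module.End.one_apply]

@[simp]
theorem geomRep_apply_inv_self (w : W) (x : B → ℝ) : cs.geomRep w (cs.geomRep w⁻¹ x) = x := by
  rw [← geomRep_mul_apply, mul_inv_cancel, map_one, Module.End.one_apply]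

theorem cosForm_geomRep (w : W) (x y : B → ℝ) :
    M.cosForm (cs.geomRep w x) (cs.geomRep w y) = M.cosForm x y := by
  induction w using cs.simple_induction_left generalizing x y with
  | one => simp
  | mul_simple_left w i ih =>
    rw [geomRep_mul_apply, geomRep_mul_apply, geomRep_simple,
      M.cosForm_rootReflection (M.cosForm_simpleRoot_self i), ih]

theorem geomRep_conj_simple (w : W) (i : B) :
    cs.geomRep (w * cs.simple i * w⁻¹) = M.rootReflection (cs.geomRep w (simpleRoot i)) := by
  refine LinearMap.ext fun x => ?_
  have h : M.cosForm (cs.geomRep w⁻¹ x) (simpleRoot i) =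
      M.cosForm x (cs.geomRep w (simpleRoot i)) := by
    rw [← cs.cosForm_geomRep w, geomRep_apply_inv_self]
  simp only [geomRep_mul_apply, geomRep_simple, rootReflection_apply, map_sub, map_smul, h,
    geomRep_apply_inv_self]

theorem simpleRoot_ne_zero (i : B) : simpleRoot i ≠ 0 := by
  simp [simpleRoot]

theorem simpleRoot_nonneg (i : B) : 0 ≤ simpleRoot i :=
  Pi.single_nonneg.mpr zero_le_one

section Finite

variable [Finite W]

theorem exists_invariant_form : ∃ A : LinearMap.BilinForm ℝ (B → ℝ),
    (∀ w x y, A (cs.geomRep w x) (cs.geomRep w y) = A x y) ∧ (∀ x y, A x y = A y x) ∧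
      ∀ x, x ≠ 0 → 0 < A x x := by
  have := Fintype.ofFinite W
  let A : LinearMap.BilinForm ℝ (B → ℝ) :=
    ∑ w : W, (dotProductBilin ℝ ℝ).compl₁₂ (cs.geomRep w) (cs.geomRep w)
  have hA (x y) : A x y = ∑ w : W, cs.geomRep w x ⬝ᵥ cs.geomRep w y := by
    simp [A, LinearMap.sum_apply, dotProductBilin]
  refine ⟨A, fun w x y => ?_, fun x y => ?_, fun x hx => ?_⟩
  · simp only [hA, ← geomRep_mul_apply]
    exact Fintype.sum_equiv (Equiv.mulRight w) _ _ fun v => rfl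
  · simp only [hA, dotProduct_comm]
  · rw [hA]
    refine Finset.sum_pos' (fun w _ => ?_) ⟨1, Finset.mem_univ _, ?_⟩
    · exact Finset.sum_nonneg fun i _ => mul_self_nonneg _
    · obtain ⟨i, hi⟩ := Function.ne_iff.mp hx
      simp only [map_one, Module.End.one_apply]
      exact Finset.sum_pos' (fun i _ => mul_self_nonneg _)
        ⟨i, Finset.mem_univ _, mul_self_pos.mpr hi⟩

theorem cosForm_eq_sum (x y : B → ℝ) : M.cosForm x y =
    ∑ i, ∑ j, x i * y j * M.cosForm (simpleRoot i) (simpleRoot j) := by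
  conv_lhs => rw [eq_sum_smul_simpleRoot x, eq_sum_smul_simpleRoot y]
  simp only [map_sum, LinearMap.sum_apply, map_smul, LinearMap.smul_apply, smul_eq_mul]
  simp only [Finset.mul_sum]
  rw [Finset.sum_comm]
  refine Finset.sum_congr rfl fun i _ => Finset.sum_congr rfl fun j _ => ?_
  ring

theorem cosForm_pos (cs : CoxeterSystem M W) {x : B → ℝ} (hx : x ≠ 0) : 0 < M.cosForm x x := by
  obtain ⟨A, hinv, hsymm, hpos⟩ := cs.exists_invariant_form
  set q : B → ℝ := fun i => A (simpleRoot i) (simpleRoot i) with hq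
  have hq0 (i) : 0 < q i := hpos _ (simpleRoot_ne_zero i)
  have hA (y) (i : B) : A y (simpleRoot i) = M.cosForm y (simpleRoot i) * q i := by
    have h := hinv (cs.simple i) y (simpleRoot i)
    rw [geomRep_simple, M.rootReflection_self (M.cosForm_simpleRoot_self i),
      rootReflection_apply] at h
    simp only [map_sub, map_neg, map_smul, LinearMap.sub_apply, LinearMap.smul_apply,
      smul_eq_mul] at h
    simp only [hq]
    linarith
  have hqq (i j : B) (h : M.cosForm (simpleRoot i) (simpleRoot j) ≠ 0) : q i = q j := by
    have h1 := hA (simpleRoot i) j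
    rw [hsymm, hA, M.cosForm_comm] at h1
    exact mul_left_cancel₀ h h1
  set y : B → ℝ := fun i => x i / √(q i) with hy
  have hy0 : y ≠ 0 := by
    obtain ⟨i, hi⟩ := Function.ne_iff.mp hx
    exact Function.ne_iff.mpr ⟨i, div_ne_zero hi (Real.sqrt_pos.mpr (hq0 i)).ne'⟩
  convert hpos y hy0 using 1
  conv_rhs => rw [eq_sum_smul_simpleRoot y]
  simp only [map_sum, LinearMap.sum_apply, map_smul, LinearMap.smul_apply, smul_eq_mul, hA]
  rw [M.cosForm_comm, cosForm_eq_sum, Finset.sum_comm]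
  simp only [Finset.mul_sum]
  refine Finset.sum_congr rfl fun i _ => Finset.sum_congr rfl fun j _ => ?_
  by_cases h : M.cosForm (simpleRoot j) (simpleRoot i) = 0
  · simp [h]
  · have hs : √(q i) * √(q i) = q i := Real.mul_self_sqrt (hq0 i).le
    have hs0 := (Real.sqrt_pos.mpr (hq0 i)).ne'
    simp only [hy, hqq j i h]
    field_simp
    rw [sq, hs]

theorem coxeterMatrix_ne_zero (cs : CoxeterSystem M W) (i j : B) : M i j ≠ 0 := by
  intro h
  have hij : i ≠ j := by
    rintro rfl
    simp at h
  have hne : simpleRoot i + simpleRoot j ≠ 0 := by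
    intro h0
    have := congrFun h0 i
    simp [simpleRoot, hij] at this
  have := cs.cosForm_pos hne
  simp only [map_add, LinearMap.add_apply, cosForm_simpleRoot_self, cosForm_simpleRoot,
    M.symmetric j i, h] at this
  norm_num at this

end Finite

theorem wordProd_alternatingWord_simpleRoot (i j : B) (k : ℕ) :
    Real.sin (Real.pi / M i j) • cs.geomRep (cs.wordProd (alternatingWord i j k)) (simpleRoot i) =
      Real.sin ((k + 1 : ℕ) * (Real.pi / M i j)) • simpleRoot (if Even k then i else j) +
      Real.sin (k * (Real.pi / M i j)) • simpleRoot (if Even k then j else i) := by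
  induction k with
  | zero => simp [alternatingWord]
  | succ k ih =>
    rw [alternatingWord_succ', wordProd_cons, geomRep_mul_apply, ← map_smul, ih, geomRep_simple]
    have e1 : ((k + 1 : ℕ) : ℝ) * (Real.pi / M i j) =
      k * (Real.pi / M i j) + Real.pi / M i j := by push_cast; ring
    have e2 : ((k + 1 + 1 : ℕ) : ℝ) * (Real.pi / M i j) =
      k * (Real.pi / M i j) + 2 * (Real.pi / M i j) := by push_cast; ring
    rw [e1, e2]
    by_cases hk : Even k
    · have := M.rootReflection_sin i j (k * (Real.pi / M i j))
      simp only [hk, Nat.even_add_one, if_true, not_true, if_false]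
      rw [this, add_comm]
    · have := M.rootReflection_sin j i (k * (Real.pi / M i j))
      rw [M.symmetric j i] at this
      simp only [hk, Nat.even_add_one, if_true, not_false_iff, if_false]
      rw [this, add_comm]

theorem geomRep_alternatingWord_nonneg {i j : B} (hij : i ≠ j) (h0 : M i j ≠ 0) {k : ℕ}
    (hk : k < M i j) :
    ∃ a b : ℝ, 0 ≤ a ∧ 0 ≤ b ∧ cs.geomRep (cs.wordProd (alternatingWord i j k)) (simpleRoot i) =
      a • simpleRoot i + b • simpleRoot j := by
  have hs := M.sin_pi_div_pos hij h0
  have hsin (l : ℕ) (hl : l ≤ M i j) : 0 ≤ Real.sin (l * (Real.pi / M i j)) := by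
    apply Real.sin_nonneg_of_nonneg_of_le_pi
    · have := Real.pi_pos
      positivity
    · have : (l : ℝ) ≤ M i j := by exact_mod_cast hl
      have hm : (0 : ℝ) < M i j := by exact_mod_cast Nat.pos_of_ne_zero h0
      calc (l : ℝ) * (Real.pi / M i j) ≤ M i j * (Real.pi / M i j) := by gcongr
        _ = Real.pi := by field_simp
  have h := cs.wordProd_alternatingWord_simpleRoot i j k
  have hroot : cs.geomRep (cs.wordProd (alternatingWord i j k)) (simpleRoot i) =
      (Real.sin ((k + 1 : ℕ) * (Real.pi / M i j)) / Real.sin (Real.pi / M i j)) •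
        simpleRoot (if Even k then i else j) +
      (Real.sin (k * (Real.pi / M i j)) / Real.sin (Real.pi / M i j)) •
        simpleRoot (if Even k then j else i) := by
    apply smul_right_injective _ hs.ne'
    simp only [h, smul_add, smul_smul]
    congr 2 <;> field_simp
  have p1 := div_nonneg (hsin (k + 1) hk) hs.le
  have p2 := div_nonneg (hsin k hk.le) hs.le
  by_cases hk : Even k
  · simp only [hk, if_true] at hroot
    exact ⟨_, _, p1, p2, hroot⟩
  · simp only [hk, if_false] at hroot
    exact ⟨_, _, p2, p1, by rw [hroot, add_comm]⟩

/-- If `s i` is not a right descent of `w`, then `w` sends the simple root `α i` to a positive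
root. -/
theorem geomRep_simpleRoot_nonneg (hM : ∀ i j, M i j ≠ 0) (w : W) (i : B)
    (hi : ¬ cs.IsRightDescent w i) : 0 ≤ cs.geomRep w (simpleRoot i) := by
  induction hn : cs.length w using Nat.strong_induction_on generalizing w i with
  | _ n ih =>
  subst hn
  by_cases hw : w = 1
  · subst hw
    simpa using simpleRoot_nonneg i
  obtain ⟨j, hj⟩ := cs.exists_rightDescent_of_ne_one hw
  have hij : i ≠ j := by
    rintro rfl
    exact hi hj
  -- `P k`: one can split off an alternating word of length `k` on the right of `w`
  let P (k : ℕ) : Prop :=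
    ∃ v, w = v * cs.wordProd (alternatingWord i j k) ∧ cs.length v + k = cs.length w
  have hP1 : P 1 := by
    refine ⟨w * cs.simple j, by simp [alternatingWord], ?_⟩
    exact cs.isRightDescent_iff.mp hj
  have hPb (k) (hk : P k) : k ≤ cs.length w := by
    obtain ⟨v, -, hv⟩ := hk
    omega
  classical
  set k := Nat.findGreatest P (cs.length w)
  have hPk : P k := Nat.findGreatest_spec (hPb 1 hP1) hP1
  have hmax : ¬ P (k + 1) := fun h => by
    have := Nat.le_findGreatest (hPb _ h) h
    change k + 1 ≤ k at this
    omega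
  have hk1 : 1 ≤ k := Nat.le_findGreatest (hPb 1 hP1) hP1
  have hdrop (l : ℕ) (hl : P (l + 1)) : P l := by
    obtain ⟨v, hv, hlen⟩ := hl
    rw [alternatingWord_succ', wordProd_cons] at hv
    refine ⟨v * cs.simple (if Even l then j else i), by rw [hv, mul_assoc], ?_⟩
    have h1 := cs.length_mul_simple v (if Even l then j else i)
    have h2 := cs.length_mul_le (v * cs.simple (if Even l then j else i))
      (cs.wordProd (alternatingWord i j l))
    rw [mul_assoc, ← hv] at h2
    have h3 := cs.length_wordProd_le (alternatingWord i j l)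
    rw [length_alternatingWord] at h3
    omega
  have hlt : k < M i j := by
    by_contra! hge
    have hPm : P (M i j) := Nat.decreasingInduction' (fun l _ _ => hdrop l) hge hPk
    obtain ⟨v, hv, hlen⟩ := hPm
    have hb := cs.wordProd_braidWord_eq i j
    rw [braidWord, braidWord, M.symmetric j i] at hb
    rw [hb] at hv
    obtain ⟨m, hm⟩ := Nat.exists_eq_succ_of_ne_zero (hM i j)
    rw [hm, Nat.succ_eq_add_one, alternatingWord_succ, wordProd_concat, ← mul_assoc] at hv
    apply hi
    have h3 := cs.length_wordProd_le (alternatingWord i j m)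
    rw [length_alternatingWord] at h3
    have h2 := cs.length_mul_le v (cs.wordProd (alternatingWord i j m))
    rw [IsRightDescent]
    nth_rw 1 [hv]
    rw [simple_mul_simple_cancel_right]
    omega
  obtain ⟨v, hv, hlen⟩ := hPk
  have hvi (l : B) (hl : l = i ∨ l = j) : ¬ cs.IsRightDescent v l := by
    intro hd
    rw [isRightDescent_iff] at hd
    obtain ⟨m, hm⟩ := Nat.exists_eq_succ_of_ne_zero (Nat.one_le_iff_ne_zero.mp hk1)
    by_cases hl' : l = if Even k then j else i
    · apply hmax
      refine ⟨v * cs.simple l, ?_, by omega⟩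
      rw [alternatingWord_succ', wordProd_cons, ← hl', ← mul_assoc,
        simple_mul_simple_cancel_right, ← hv]
    · have hl'' : l = if Even m then j else i := by
        simp only [hm, Nat.succ_eq_add_one, Nat.even_add_one] at hl'
        grind
      rw [hm, Nat.succ_eq_add_one, alternatingWord_succ', wordProd_cons, ← hl'', ← mul_assoc] at hv
      have h2 := cs.length_mul_le (v * cs.simple l) (cs.wordProd (alternatingWord i j m))
      have h3 := cs.length_wordProd_le (alternatingWord i j m)
      rw [length_alternatingWord] at h3
      rw [← hv] at h2
      omega
  obtain ⟨a, b, ha, hb, hab⟩ := cs.geomRep_alternatingWord_nonneg hij (hM i j) hlt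
  rw [hv, geomRep_mul_apply, hab, map_add, map_smul, map_smul]
  have hl : cs.length v < cs.length w := by omega
  exact add_nonneg (smul_nonneg ha (ih _ hl v i (hvi i (Or.inl rfl)) rfl))
    (smul_nonneg hb (ih _ hl v j (hvi j (Or.inr rfl)) rfl))

/-- A root is an element of the orbit of a simple root. -/
def IsRoot (β : B → ℝ) : Prop := ∃ w i, β = cs.geomRep w (simpleRoot i)

variable {cs} in
theorem IsRoot.geomRep {β : B → ℝ} (hβ : cs.IsRoot β) (w : W) : cs.IsRoot (cs.geomRep w β) := by
  obtain ⟨v, i, rfl⟩ := hβ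
  exact ⟨w * v, i, (cs.geomRep_mul_apply _ _ _).symm⟩

theorem isRoot_simpleRoot (i : B) : cs.IsRoot (simpleRoot i) := ⟨1, i, by simp⟩

variable {cs} in
theorem IsRoot.neg {β : B → ℝ} (hβ : cs.IsRoot β) : cs.IsRoot (-β) := by
  obtain ⟨v, i, rfl⟩ := hβ
  refine ⟨v * cs.simple i, i, ?_⟩
  rw [geomRep_mul_apply, geomRep_simple, M.rootReflection_self (M.cosForm_simpleRoot_self i),
    map_neg]

variable {cs} in
theorem IsRoot.cosForm_self {β : B → ℝ} (hβ : cs.IsRoot β) : M.cosForm β β = 1 := by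
  obtain ⟨v, i, rfl⟩ := hβ
  rw [cosForm_geomRep, cosForm_simpleRoot_self]

variable {cs} in
theorem IsRoot.ne_zero {β : B → ℝ} (hβ : cs.IsRoot β) : β ≠ 0 := by
  rintro rfl
  simpa using hβ.cosForm_self

theorem finite_setOf_isRoot [Finite W] : {β | cs.IsRoot β}.Finite := by
  refine (Set.finite_range fun p : W × B => cs.geomRep p.1 (simpleRoot p.2)).subset ?_
  rintro β ⟨w, i, rfl⟩
  exact ⟨(w, i), rfl⟩

theorem geomRep_simpleRoot_nonpos [Finite W] {w : W} {i : B} (hi : cs.IsRightDescent w i) :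
    cs.geomRep w (simpleRoot i) ≤ 0 := by
  rw [isRightDescent_iff_not_isRightDescent_mul] at hi
  have := cs.geomRep_simpleRoot_nonneg cs.coxeterMatrix_ne_zero _ i hi
  rw [geomRep_mul_apply, geomRep_simple, M.rootReflection_self (M.cosForm_simpleRoot_self i),
    map_neg] at this
  exact neg_nonneg.mp this

variable {cs} in
theorem IsRoot.nonneg_or_nonpos [Finite W] {β : B → ℝ} (hβ : cs.IsRoot β) : 0 ≤ β ∨ β ≤ 0 := by
  obtain ⟨w, i, rfl⟩ := hβ
  by_cases hi : cs.IsRightDescent w i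
  · exact Or.inr (cs.geomRep_simpleRoot_nonpos hi)
  · exact Or.inl (cs.geomRep_simpleRoot_nonneg cs.coxeterMatrix_ne_zero _ i hi)

theorem eq_one_of_forall_nonneg [Finite W] {w : W}
    (hw : ∀ i, 0 ≤ cs.geomRep w (simpleRoot i)) : w = 1 := by
  by_contra h
  obtain ⟨i, hi⟩ := cs.exists_rightDescent_of_ne_one h
  have h0 := le_antisymm (cs.geomRep_simpleRoot_nonpos hi) (hw i)
  exact ((cs.isRoot_simpleRoot i).geomRep w).ne_zero h0

theorem geomRep_injective [Finite W] : Function.Injective cs.geomRep := by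
  rw [injective_iff_map_eq_one]
  intro w hw
  apply cs.eq_one_of_forall_nonneg
  intro i
  rw [hw]
  exact simpleRoot_nonneg i

end CoxeterSystem

section AbsoluteOrder

variable {G : Type*} [Group G] {S : Set G}

/-- Every element of the group is a product of reflections. -/
def ReflectionsGenerate (S : Set G) : Prop :=
  ∀ w : G, ∃ l : List G, (∀ t ∈ l, IsReflectionOf S t) ∧ l.prod = w

theorem IsReflectionOf.conj {t : G} (ht : IsReflectionOf S t) (g : G) :
    IsReflectionOf S (g * t * g⁻¹) := by
  obtain ⟨k, s, hs, rfl⟩ := ht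
  exact ⟨g * k, s, hs, by group⟩

theorem absLength_le_length {l : List G} (hl : ∀ t ∈ l, IsReflectionOf S t) :
    absLength S l.prod ≤ l.length :=
  Nat.sInf_le ⟨l, hl, rfl, rfl⟩

theorem ReflectionsGenerate.exists_list (hS : ReflectionsGenerate S) (w : G) :
    ∃ l : List G, (∀ t ∈ l, IsReflectionOf S t) ∧ l.length = absLength S w ∧ l.prod = w := by
  obtain ⟨l, hl, hw⟩ := hS w
  exact Nat.sInf_mem (s := {k | ∃ l : List G, (∀ t ∈ l, IsReflectionOf S t) ∧
    l.length = k ∧ l.prod = w}) ⟨l.length, l, hl, rfl, hw⟩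

theorem ReflectionsGenerate.absLength_mul_le (hS : ReflectionsGenerate S) (u v : G) :
    absLength S (u * v) ≤ absLength S u + absLength S v := by
  obtain ⟨l, hl, hlen, rfl⟩ := hS.exists_list u
  obtain ⟨l', hl', hlen', rfl⟩ := hS.exists_list v
  rw [← hlen, ← hlen', ← List.prod_append, ← List.length_append]
  apply absLength_le_length
  simp only [List.mem_append]
  rintro t (h | h)
  exacts [hl t h, hl' t h]

theorem absLength_le_one {t : G} (ht : IsReflectionOf S t) : absLength S t ≤ 1 := by
  have := absLength_le_length (S := S) (l := [t]) (by simpa using ht)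
  simpa using this

theorem ReflectionsGenerate.isReflectionOf_of_absLength_eq_one (hS : ReflectionsGenerate S) {t : G}
    (ht : absLength S t = 1) : IsReflectionOf S t := by
  obtain ⟨l, hl, hlen, rfl⟩ := hS.exists_list t
  rw [ht] at hlen
  obtain ⟨a, rfl⟩ := List.length_eq_one_iff.mp hlen
  simpa using hl a

theorem ReflectionsGenerate.absLength_conj (hS : ReflectionsGenerate S) (g w : G) :
    absLength S (g * w * g⁻¹) = absLength S w := by
  have key (g w : G) : absLength S (g * w * g⁻¹) ≤ absLength S w := by
    obtain ⟨l, hl, hlen, rfl⟩ := hS.exists_list w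
    rw [← hlen, ← MulAut.conj_apply, map_list_prod, ← List.length_map (MulAut.conj g)]
    apply absLength_le_length
    simp only [List.mem_map]
    rintro _ ⟨t, ht, rfl⟩
    exact (hl t ht).conj g
  refine le_antisymm (key g w) ?_
  simpa [mul_assoc] using key g⁻¹ (g * w * g⁻¹)

theorem ReflectionsGenerate.absLe_conj_iff (hS : ReflectionsGenerate S) (g u v : G) :
    absLe S (g * u * g⁻¹) (g * v * g⁻¹) ↔ absLe S u v := by
  have h : (g * u * g⁻¹)⁻¹ * (g * v * g⁻¹) = g * (u⁻¹ * v) * g⁻¹ := by group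
  rw [absLe, absLe, h, hS.absLength_conj, hS.absLength_conj, hS.absLength_conj]

theorem ReflectionsGenerate.ncCount_conj (hS : ReflectionsGenerate S) (g w : G) :
    ncCount S (g * w * g⁻¹) = ncCount S w := by
  refine (Nat.card_congr ?_).symm
  exact (MulAut.conj g).toEquiv.subtypeEquiv fun u => (hS.absLe_conj_iff g u w).symm

theorem ReflectionsGenerate.ncCount_eq_of_isConj (hS : ReflectionsGenerate S) {v w : G}
    (h : IsConj v w) : ncCount S v = ncCount S w := by
  obtain ⟨g, rfl⟩ := isConj_iff.mp h
  exact (hS.ncCount_conj g v).symm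

theorem ReflectionsGenerate.absLe_iff_exists (hS : ReflectionsGenerate S) {u v : G} :
    absLe S u v ↔ ∃ l l' : List G, (∀ t ∈ l ++ l', IsReflectionOf S t) ∧ l.prod = u ∧
      (l ++ l').prod = v ∧ (l ++ l').length = absLength S v := by
  constructor
  · intro h
    obtain ⟨l, hl, hlen, hu⟩ := hS.exists_list u
    obtain ⟨l', hl', hlen', hv⟩ := hS.exists_list (u⁻¹ * v)
    refine ⟨l, l', fun t ht => ?_, hu, ?_, ?_⟩
    · rcases List.mem_append.mp ht with h | h
      exacts [hl t h, hl' t h]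
    · rw [List.prod_append, hu, hv, mul_inv_cancel_left]
    · rw [List.length_append, hlen, hlen', h]
  · rintro ⟨l, l', hl, rfl, rfl, hlen⟩
    rw [List.prod_append, List.length_append] at hlen
    rw [absLe, List.prod_append, inv_mul_cancel_left]
    have h1 := absLength_le_length (S := S) (l := l) fun t ht => hl t (List.mem_append_left _ ht)
    have h2 := absLength_le_length (S := S) (l := l') fun t ht => hl t (List.mem_append_right _ ht)
    have h3 := hS.absLength_mul_le l.prod l'.prod
    omega

end AbsoluteOrder

namespace CoxeterSystem

variable {B : Type*} [Fintype B] [DecidableEq B] {W : Type*} [Group W] {M : CoxeterMatrix B}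
  (cs : CoxeterSystem M W)

/-- The span of the simple roots indexed by `J`. -/
def rootSpan (J : Set B) : Submodule ℝ (B → ℝ) := Submodule.span ℝ (simpleRoot '' J)

theorem simpleRoot_mem_rootSpan {J : Set B} {j : B} (hj : j ∈ J) : simpleRoot j ∈ rootSpan J :=
  Submodule.subset_span ⟨j, hj, rfl⟩

theorem mem_rootSpan_iff {J : Set B} {x : B → ℝ} : x ∈ rootSpan J ↔ ∀ i ∉ J, x i = 0 := by
  constructor
  · intro hx i hi
    induction hx using Submodule.span_induction with
    | mem x h =>
      obtain ⟨j, hj, rfl⟩ := h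
      have : i ≠ j := by
        rintro rfl
        exact hi hj
      simp [simpleRoot, this]
    | zero => rfl
    | add x y _ _ hx hy => simp [hx, hy]
    | smul a x _ hx => simp [hx]
  · intro hx
    rw [eq_sum_smul_simpleRoot x]
    refine Submodule.sum_mem _ fun i _ => ?_
    by_cases hi : i ∈ J
    · exact Submodule.smul_mem _ _ (simpleRoot_mem_rootSpan hi)
    · simp [hx i hi]

theorem linearIndependent_simpleRoot : LinearIndependent ℝ (simpleRoot (B := B)) := by
  have h := (Pi.basisFun ℝ B).linearIndependent
  have e : (simpleRoot (B := B)) = Pi.basisFun ℝ B := by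
    ext i
    simp [simpleRoot]
  rwa [e]

theorem finrank_rootSpan {l : List B} (hl : l.Nodup) :
    Module.finrank ℝ (rootSpan {i | i ∈ l}) = l.length := by
  have h : LinearIndependent ℝ fun i : {i // i ∈ l} => simpleRoot i.1 :=
    linearIndependent_simpleRoot.comp _ Subtype.val_injective
  have h' := finrank_span_eq_card h
  have e : Set.range (fun i : {i // i ∈ l} => simpleRoot i.1) = simpleRoot '' {i | i ∈ l} := by
    ext x
    simp
  rw [e] at h'
  rw [rootSpan, h', Fintype.card_of_subtype l.toFinset (by simp), List.toFinset_card_of_nodup hl]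

theorem isReflectionOf_iff {t : W} :
    IsReflectionOf (simpleSet cs) t ↔ ∃ w i, t = w * cs.simple i * w⁻¹ := by
  simp [IsReflectionOf, simpleSet]

theorem exists_root_of_isReflectionOf {t : W} (ht : IsReflectionOf (simpleSet cs) t) :
    ∃ β, cs.IsRoot β ∧ cs.geomRep t = M.rootReflection β := by
  obtain ⟨w, i, rfl⟩ := cs.isReflectionOf_iff.mp ht
  exact ⟨_, ⟨w, i, rfl⟩, cs.geomRep_conj_simple w i⟩

theorem geomRep_prod_sub_mem {l : List W} {U : Submodule ℝ (B → ℝ)}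
    (hl : ∀ t ∈ l, ∃ β ∈ U, cs.geomRep t = M.rootReflection β) (x : B → ℝ) :
    cs.geomRep l.prod x - x ∈ U := by
  induction l with
  | nil => simp
  | cons t l ih =>
    obtain ⟨β, hβ, h⟩ := hl t List.mem_cons_self
    have ih := ih fun t ht => hl t (List.mem_cons_of_mem _ ht)
    rw [List.prod_cons, geomRep_mul_apply, h, rootReflection_apply, sub_right_comm]
    exact Submodule.sub_mem _ ih (Submodule.smul_mem _ _ hβ)

theorem geomRep_wordProd_sub_mem (l : List B) (x : B → ℝ) :
    cs.geomRep (cs.wordProd l) x - x ∈ rootSpan {i | i ∈ l} := by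
  apply cs.geomRep_prod_sub_mem
  simp only [List.mem_map]
  rintro _ ⟨i, hi, rfl⟩
  exact ⟨_, simpleRoot_mem_rootSpan hi, cs.geomRep_simple i⟩

theorem cosForm_simpleRoot_eq_zero_of_fixed {l : List B} (hl : l.Nodup) {x : B → ℝ}
    (hx : cs.geomRep (cs.wordProd l) x = x) : ∀ j ∈ l, M.cosForm x (simpleRoot j) = 0 := by
  induction l with
  | nil => simp
  | cons i l ih =>
    obtain ⟨hi, hl⟩ := List.nodup_cons.mp hl
    rw [wordProd_cons, geomRep_mul_apply] at hx
    have h1 : cs.geomRep (cs.wordProd l) x = cs.geomRep (cs.simple i) x := by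
      nth_rw 2 [← hx]
      rw [← geomRep_mul_apply, ← geomRep_mul_apply, simple_mul_simple_self, one_mul]
    have h2 := mem_rootSpan_iff.mp (cs.geomRep_wordProd_sub_mem l x) i hi
    rw [h1, geomRep_simple, rootReflection_apply] at h2
    have h3 : M.cosForm x (simpleRoot i) = 0 := by simpa [simpleRoot] using h2
    rw [geomRep_simple, rootReflection_apply, h3] at h1
    simp only [List.mem_cons, forall_eq_or_imp]
    exact ⟨h3, ih hl (by simpa using h1)⟩

variable [Finite W]

theorem rootSpan_le_of_prod_eq_wordProd {l : List B} (hl : l.Nodup) {ts : List W}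
    (hts : ts.prod = cs.wordProd l) {U : Submodule ℝ (B → ℝ)}
    (hU : ∀ t ∈ ts, ∃ β ∈ U, cs.geomRep t = M.rootReflection β) :
    rootSpan {i | i ∈ l} ≤ U := by
  set D : Module.End ℝ (B → ℝ) := cs.geomRep (cs.wordProd l) - 1 with hD
  set V := rootSpan {i | i ∈ l}
  have hDV : Submodule.map D V ≤ V := by
    rintro _ ⟨x, -, rfl⟩
    exact cs.geomRep_wordProd_sub_mem l x
  have hinj : Function.Injective (D.domRestrict V) := by
    rw [← LinearMap.ker_eq_bot, LinearMap.ker_eq_bot']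
    rintro ⟨x, hx⟩ h0
    have h1 : cs.geomRep (cs.wordProd l) x = x := by
      simpa [hD, sub_eq_zero] using h0
    have h2 : M.cosForm x x = 0 := by
      have h3 := cs.cosForm_simpleRoot_eq_zero_of_fixed hl h1
      conv_lhs => arg 2; rw [eq_sum_smul_simpleRoot x]
      rw [map_sum]
      refine Finset.sum_eq_zero fun i _ => ?_
      by_cases hi : i ∈ l
      · simp [h3 i hi]
      · simp [mem_rootSpan_iff.mp hx i hi]
    rw [Submodule.mk_eq_zero]
    by_contra hne
    exact (cs.cosForm_pos hne).ne' h2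
  have hrank : Module.finrank ℝ (Submodule.map D V) = Module.finrank ℝ V := by
    rw [← LinearMap.range_domRestrict]
    exact LinearMap.finrank_range_of_inj hinj
  rw [← Submodule.eq_of_le_of_finrank_eq hDV hrank]
  rintro _ ⟨x, -, rfl⟩
  have := cs.geomRep_prod_sub_mem hU x
  rwa [hts] at this

theorem length_le_of_prod_eq_wordProd {l : List B} (hl : l.Nodup) {ts : List W}
    (hts : ts.prod = cs.wordProd l) (hT : ∀ t ∈ ts, IsReflectionOf (simpleSet cs) t) :
    l.length ≤ ts.length ∧ (ts.length = l.length → ∀ t ∈ ts, ∃ β ∈ rootSpan {i | i ∈ l},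
      cs.IsRoot β ∧ cs.geomRep t = M.rootReflection β) := by
  classical
  choose! r hr hr' using fun t (ht : t ∈ ts) => cs.exists_root_of_isReflectionOf (hT t ht)
  set U : Submodule ℝ (B → ℝ) := Submodule.span ℝ ((ts.toFinset.image r : Finset (B → ℝ)) : Set _)
  have hU (t) (ht : t ∈ ts) : r t ∈ U := Submodule.subset_span (by simpa using ⟨t, ht, rfl⟩)
  have hle := cs.rootSpan_le_of_prod_eq_wordProd hl hts (U := U)
    fun t ht => ⟨r t, hU t ht, hr' t ht⟩
  have hfin : Module.finrank ℝ U ≤ ts.length :=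
    (finrank_span_finset_le_card _).trans (Finset.card_image_le.trans ts.toFinset_card_le)
  refine ⟨?_, fun hlen t ht => ⟨r t, ?_, hr t ht, hr' t ht⟩⟩
  · rw [← finrank_rootSpan hl]
    exact (Submodule.finrank_mono hle).trans hfin
  · rw [Submodule.eq_of_le_of_finrank_le hle (by rw [finrank_rootSpan hl]; omega)]
    exact hU t ht

theorem absLength_wordProd_of_nodup {l : List B} (hl : l.Nodup) :
    absLength (simpleSet cs) (cs.wordProd l) = l.length := by
  have hT : ∀ t ∈ l.map cs.simple, IsReflectionOf (simpleSet cs) t := by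
    simp only [List.mem_map]
    rintro _ ⟨i, -, rfl⟩
    exact ⟨1, cs.simple i, ⟨i, rfl⟩, by simp⟩
  apply le_antisymm
  · simpa [wordProd] using absLength_le_length hT
  · refine le_csInf ⟨_, _, hT, rfl, rfl⟩ ?_
    rintro _ ⟨ts, hts, rfl, hprod⟩
    exact (cs.length_le_of_prod_eq_wordProd hl hprod hts).1

theorem reflectionsGenerate : ReflectionsGenerate (simpleSet cs) := by
  intro w
  obtain ⟨l, rfl⟩ := cs.wordProd_surjective w
  refine ⟨l.map cs.simple, ?_, rfl⟩
  simp only [List.mem_map]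
  rintro _ ⟨i, -, rfl⟩
  exact ⟨1, cs.simple i, ⟨i, rfl⟩, by simp⟩

variable {cs} in
theorem IsRoot.eq_simpleRoot {β : B → ℝ} (hβ : cs.IsRoot β) (h0 : 0 ≤ β) {j : B}
    (h : cs.geomRep (cs.simple j) β ≤ 0) : β = simpleRoot j := by
  rw [geomRep_simple, rootReflection_apply] at h
  have hzero (i : B) (hi : i ≠ j) : β i = 0 := by
    have := h i
    simp only [Pi.sub_apply, Pi.smul_apply, simpleRoot, Pi.single_eq_of_ne hi, smul_zero,
      sub_zero] at this
    exact le_antisymm this (h0 i)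
  have hβeq : β = β j • simpleRoot j := by
    ext i
    by_cases hi : i = j
    · subst hi
      simp [simpleRoot]
    · simp [simpleRoot, hi, hzero i hi]
  have h1 := hβ.cosForm_self
  have h3 : 0 ≤ β j := h0 j
  rw [hβeq] at h1
  simp only [map_smul, LinearMap.smul_apply, cosForm_simpleRoot_self, smul_eq_mul, mul_one] at h1
  have h2 : β j = 1 := by nlinarith
  rwa [h2, one_smul] at hβeq

/-- A positive root in the span of the simple roots indexed by `J` lies in the orbit of one of them
under the parabolic subgroup generated by `J`. -/
theorem exists_of_nonneg_mem_rootSpan {J : Set B} {β : B → ℝ} (hβ : cs.IsRoot β) (h0 : 0 ≤ β)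
    (hJ : β ∈ rootSpan J) :
    ∃ w ∈ Subgroup.closure (cs.simple '' J), ∃ j ∈ J, β = cs.geomRep w (simpleRoot j) := by
  classical
  let X : Set (B → ℝ) := {β | cs.IsRoot β ∧ 0 ≤ β ∧ β ∈ rootSpan J ∧
    ¬ ∃ w ∈ Subgroup.closure (cs.simple '' J), ∃ j ∈ J, β = cs.geomRep w (simpleRoot j)}
  have hX : X.Finite := cs.finite_setOf_isRoot.subset fun _ h => h.1
  by_contra hne
  obtain ⟨β, ⟨hβ, h0, hJ, hne⟩, hmin⟩ := hX.exists_minimalFor (fun β => ∑ i, β i) X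
    ⟨β, hβ, h0, hJ, hne⟩
  have hpos : 0 < ∑ i, β i * M.cosForm β (simpleRoot i) := by
    have h1 := hβ.cosForm_self
    have h2 : M.cosForm β β = ∑ i, β i * M.cosForm β (simpleRoot i) := by
      conv_lhs => arg 2; rw [eq_sum_smul_simpleRoot β]
      simp
    rw [← h2, h1]
    exact one_pos
  obtain ⟨j, hj⟩ : ∃ j, 0 < β j * M.cosForm β (simpleRoot j) := by
    by_contra! hle
    exact hpos.not_ge (Finset.sum_nonpos fun j _ => hle j)
  have hβj : 0 < β j := lt_of_le_of_ne (h0 j) fun h => by simp [← h] at hj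
  have hfj : 0 < M.cosForm β (simpleRoot j) := pos_of_mul_pos_right hj (h0 j)
  have hjJ : j ∈ J := by
    by_contra h
    exact hβj.ne' (mem_rootSpan_iff.mp hJ j h)
  have happ : cs.geomRep (cs.simple j) β = β - (2 * M.cosForm β (simpleRoot j)) • simpleRoot j := by
    rw [geomRep_simple, rootReflection_apply]
  rcases (hβ.geomRep (cs.simple j)).nonneg_or_nonpos with h | h
  · by_cases hmem : cs.geomRep (cs.simple j) β ∈ X
    · have h1 := hmin hmem
      rw [happ] at h1
      simp only [Pi.sub_apply, Pi.smul_apply, simpleRoot, Finset.sum_sub_distrib, smul_eq_mul,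
        ← Finset.mul_sum, Finset.sum_pi_single', Finset.mem_univ, if_true] at h1
      rw [simpleRoot] at hfj
      have := h1 (by linarith)
      linarith
    · have hspan : cs.geomRep (cs.simple j) β ∈ rootSpan J := by
        rw [happ]
        exact Submodule.sub_mem _ hJ (Submodule.smul_mem _ _ (simpleRoot_mem_rootSpan hjJ))
      have hex : ∃ w ∈ Subgroup.closure (cs.simple '' J), ∃ k ∈ J,
          cs.geomRep (cs.simple j) β = cs.geomRep w (simpleRoot k) := by
        by_contra hne'
        exact hmem ⟨hβ.geomRep _, h, hspan, hne'⟩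
      obtain ⟨w, hw, k, hk, hwk⟩ := hex
      refine hne ⟨cs.simple j * w,
        Subgroup.mul_mem _ (Subgroup.subset_closure ⟨j, hjJ, rfl⟩) hw, k, hk, ?_⟩
      rw [geomRep_mul_apply, ← hwk, ← geomRep_mul_apply, simple_mul_simple_self, map_one,
        Module.End.one_apply]
  · have hβeq := hβ.eq_simpleRoot h0 h
    exact hne ⟨1, Subgroup.one_mem _, j, hjJ, by simpa using hβeq⟩

theorem exists_conj_simple_of_mem_rootSpan {J : Set B} {β : B → ℝ} (hβ : cs.IsRoot β)
    (hJ : β ∈ rootSpan J) {t : W} (ht : cs.geomRep t = M.rootReflection β) :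
    ∃ w ∈ Subgroup.closure (cs.simple '' J), ∃ j ∈ J, t = w * cs.simple j * w⁻¹ := by
  have key (γ : B → ℝ) (hγ : cs.IsRoot γ) (h0 : 0 ≤ γ) (hJ : γ ∈ rootSpan J)
      (ht : cs.geomRep t = M.rootReflection γ) :
      ∃ w ∈ Subgroup.closure (cs.simple '' J), ∃ j ∈ J, t = w * cs.simple j * w⁻¹ := by
    obtain ⟨w, hw, j, hj, rfl⟩ := cs.exists_of_nonneg_mem_rootSpan hγ h0 hJ
    refine ⟨w, hw, j, hj, cs.geomRep_injective ?_⟩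
    rw [ht, geomRep_conj_simple]
  rcases hβ.nonneg_or_nonpos with h | h
  · exact key β hβ h hJ ht
  · exact key (-β) hβ.neg (neg_nonneg.mpr h) (Submodule.neg_mem _ hJ)
      (by rw [rootReflection_neg, ht])

theorem simple_injective : Function.Injective cs.simple := by
  intro i j hij
  by_contra hne
  have h1 : cs.geomRep (cs.simple i) (simpleRoot i) i = -1 := by
    rw [geomRep_simple, M.rootReflection_self (M.cosForm_simpleRoot_self i)]
    simp [simpleRoot]
  rw [hij, geomRep_simple, rootReflection_apply] at h1
  norm_num [simpleRoot, hne] at h1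

theorem exists_wordProd_of_isCoxeterElementOf {J : Set B} {c : W}
    (hc : IsCoxeterElementOf (cs.simple '' J) c) :
    ∃ l : List B, l.Nodup ∧ (∀ i, i ∈ l ↔ i ∈ J) ∧ cs.wordProd l = c := by
  obtain ⟨l, hl, hmem, rfl⟩ := hc
  obtain ⟨l, rfl⟩ := (Set.range_list_map cs.simple).ge fun x hx => by
    obtain ⟨i, -, hi⟩ := (hmem x).mp hx
    exact ⟨i, hi⟩
  refine ⟨l, hl.of_map _, fun i => ?_, rfl⟩
  rw [← cs.simple_injective.mem_set_image, ← hmem, List.mem_map_of_injective cs.simple_injective]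

theorem range_simple_diff (s : B) : Set.range cs.simple \ {cs.simple s} = cs.simple '' {s}ᶜ := by
  rw [← Set.image_univ, ← Set.image_singleton, ← Set.image_sdiff cs.simple_injective,
    Set.compl_eq_univ_sdiff]

theorem exists_wordProd_of_isCoxeterElementOf_parabolic {s : B} {c : parabolic cs s}
    (hc : IsCoxeterElementOf (parabolicGens cs s) c) :
    ∃ l : List B, l.Nodup ∧ (∀ i, i ∈ l ↔ i ≠ s) ∧ cs.wordProd l = c := by
  apply cs.exists_wordProd_of_isCoxeterElementOf (J := {s}ᶜ)
  obtain ⟨l, hl, hmem, rfl⟩ := hc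
  refine ⟨l.map (parabolic cs s).subtype, hl.map (parabolic cs s).subtype_injective, fun x => ?_,
    ?_⟩
  · rw [← range_simple_diff, List.mem_map]
    constructor
    · rintro ⟨y, hy, rfl⟩
      exact (hmem y).mp hy
    · intro hx
      exact ⟨⟨x, Subgroup.subset_closure hx⟩, (hmem _).mpr hx, rfl⟩
  · rw [← map_list_prod]
    rfl

theorem isReflectionOf_parabolicGens {s : B} {t : parabolic cs s}
    (ht : IsReflectionOf (parabolicGens cs s) t) : IsReflectionOf (simpleSet cs) (t : W) := by
  obtain ⟨g, x, hx, rfl⟩ := ht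
  exact ⟨g, x, hx.1, rfl⟩

theorem reflectionsGenerate_parabolicGens (s : B) : ReflectionsGenerate (parabolicGens cs s) := by
  rintro ⟨w, hw⟩
  have key : ∀ v (hv : v ∈ parabolic cs s), ∃ l : List (parabolic cs s),
      (∀ t ∈ l, IsReflectionOf (parabolicGens cs s) t) ∧ l.prod = ⟨v, hv⟩ := by
    intro v hv
    induction hv using Subgroup.closure_induction with
    | mem x hx => exact ⟨[⟨x, Subgroup.subset_closure hx⟩],
        by simpa using ⟨1, ⟨x, Subgroup.subset_closure hx⟩, hx, by simp⟩, by simp⟩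
    | one => exact ⟨[], by simp, rfl⟩
    | mul x y hx hy ihx ihy =>
      obtain ⟨l, hl, h⟩ := ihx
      obtain ⟨l', hl', h'⟩ := ihy
      refine ⟨l ++ l', fun t ht => ?_, by rw [List.prod_append, h, h']; rfl⟩
      rcases List.mem_append.mp ht with ht | ht
      exacts [hl t ht, hl' t ht]
    | inv x hx ih =>
      obtain ⟨l, hl, h⟩ := ih
      refine ⟨(l.map (·⁻¹)).reverse, ?_, by rw [← List.prod_inv_reverse, h]; rfl⟩
      simp only [List.mem_reverse, List.mem_map]
      rintro _ ⟨t, ht, rfl⟩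
      obtain ⟨g, y, hy, rfl⟩ := hl t ht
      refine ⟨g, y⁻¹, ?_, by group⟩
      have hy' := hy
      obtain ⟨⟨i, hi⟩, -⟩ := hy
      have : y⁻¹ = y := by
        ext
        rw [Subgroup.coe_inv, ← hi, inv_simple]
      rwa [this]
  exact key w hw

theorem exists_lift_reflection {s : B} {l : List B} (hl : l.Nodup) (hmem : ∀ i, i ∈ l ↔ i ≠ s)
    {ts : List W} (hT : ∀ t ∈ ts, IsReflectionOf (simpleSet cs) t)
    (hprod : ts.prod = cs.wordProd l) (hlen : ts.length = l.length) :
    ∀ t ∈ ts, ∃ t' : parabolic cs s, IsReflectionOf (parabolicGens cs s) t' ∧ (t' : W) = t := by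
  intro t ht
  obtain ⟨β, hβl, hβ, htβ⟩ := (cs.length_le_of_prod_eq_wordProd hl hprod hT).2 hlen t ht
  have hJ : {i | i ∈ l} = ({s}ᶜ : Set B) := by
    ext i
    simp [hmem]
  rw [hJ] at hβl
  obtain ⟨w, hw, j, hj, rfl⟩ := cs.exists_conj_simple_of_mem_rootSpan hβ hβl htβ
  rw [← range_simple_diff] at hw
  have hjs : cs.simple j ∈ Set.range cs.simple \ {cs.simple s} := by
    rw [range_simple_diff]
    exact ⟨j, hj, rfl⟩
  exact ⟨⟨w, hw⟩ * ⟨cs.simple j, Subgroup.subset_closure hjs⟩ * ⟨w, hw⟩⁻¹,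
    ⟨⟨w, hw⟩, ⟨cs.simple j, Subgroup.subset_closure hjs⟩, hjs, rfl⟩, rfl⟩

/-- The noncrossing partition lattice of a maximal standard parabolic subgroup agrees with the
corresponding interval in the absolute order of the whole group. -/
theorem ncCount_parabolic {s : B} {c : parabolic cs s}
    (hc : IsCoxeterElementOf (parabolicGens cs s) c) :
    ncCount (parabolicGens cs s) c = ncCount (simpleSet cs) (c : W) := by
  obtain ⟨l, hl, hmem, hlc⟩ := cs.exists_wordProd_of_isCoxeterElementOf_parabolic hc
  have hlenW : absLength (simpleSet cs) (c : W) = l.length := by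
    rw [← hlc, cs.absLength_wordProd_of_nodup hl]
  have hgen := cs.reflectionsGenerate_parabolicGens s
  have hlift {ts : List W} (hT : ∀ t ∈ ts, IsReflectionOf (simpleSet cs) t)
      (hprod : ts.prod = c) (hlen : ts.length = l.length) :=
    cs.exists_lift_reflection hl hmem hT (hprod.trans hlc.symm) hlen
  have hcoe (ts : List (parabolic cs s)) :
      ((ts.prod : parabolic cs s) : W) = (ts.map (parabolic cs s).subtype).prod :=
    map_list_prod (parabolic cs s).subtype ts
  have hmap {ts : List (parabolic cs s)} (hT : ∀ t ∈ ts, IsReflectionOf (parabolicGens cs s) t) :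
      ∀ t ∈ ts.map (parabolic cs s).subtype, IsReflectionOf (simpleSet cs) t := by
    simp only [List.mem_map]
    rintro _ ⟨t, ht, rfl⟩
    exact cs.isReflectionOf_parabolicGens (hT t ht)
  have hlenP : absLength (parabolicGens cs s) c = l.length := by
    apply le_antisymm
    · obtain ⟨ts, hT, hlen, hprod⟩ := cs.reflectionsGenerate.exists_list (c : W)
      have hlen := hlen.trans hlenW
      obtain ⟨ts, rfl⟩ := (Set.range_list_map (parabolic cs s).subtype).ge fun t ht => by
        obtain ⟨t', -, h⟩ := hlift hT hprod hlen t ht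
        exact ⟨t', h⟩
      have hT' (t) (ht : t ∈ ts) : IsReflectionOf (parabolicGens cs s) t := by
        obtain ⟨t', h, h'⟩ := hlift hT hprod hlen t (List.mem_map_of_mem ht)
        rwa [← Subtype.ext h']
      have h1 : ts.prod = c := Subtype.ext ((hcoe ts).trans hprod)
      rw [← h1, ← hlen, List.length_map]
      exact absLength_le_length hT'
    · obtain ⟨ts, hT, hlen, hprod⟩ := hgen.exists_list c
      rw [← hlen, ← hlenW, ← hprod, hcoe, ← List.length_map (parabolic cs s).subtype]
      exact absLength_le_length (hmap hT)
  refine Nat.card_congr (Equiv.ofBijective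
    (fun u : {u // absLe (parabolicGens cs s) u c} =>
      (⟨(u.1 : W), ?_⟩ : {w : W // absLe (simpleSet cs) w c})) ⟨?_, ?_⟩)
  · obtain ⟨ts, ts', hT, hu, hprod, hlen⟩ := hgen.absLe_iff_exists.mp u.2
    refine cs.reflectionsGenerate.absLe_iff_exists.mpr ⟨ts.map (parabolic cs s).subtype,
      ts'.map (parabolic cs s).subtype, ?_, by rw [← hu, hcoe], ?_, ?_⟩
    · rw [← List.map_append]
      exact hmap hT
    · rw [← List.map_append, ← hcoe, hprod]
    · rw [← List.map_append, List.length_map, hlen, hlenP, hlenW]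
  · intro u v huv
    have h := congrArg Subtype.val huv
    exact Subtype.ext (Subtype.ext h)
  · rintro ⟨w, hw⟩
    obtain ⟨ts, ts', hT, hu, hprod, hlen⟩ := cs.reflectionsGenerate.absLe_iff_exists.mp hw
    rw [hlenW] at hlen
    have key := hlift hT hprod hlen
    obtain ⟨ts, rfl⟩ := (Set.range_list_map (parabolic cs s).subtype).ge fun t ht => by
      obtain ⟨t', -, h⟩ := key t (List.mem_append_left _ ht)
      exact ⟨t', h⟩
    obtain ⟨ts', rfl⟩ := (Set.range_list_map (parabolic cs s).subtype).ge fun t ht => by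
      obtain ⟨t', -, h⟩ := key t (List.mem_append_right _ ht)
      exact ⟨t', h⟩
    refine ⟨⟨ts.prod, ?_⟩, Subtype.ext ((hcoe ts).trans hu)⟩
    refine hgen.absLe_iff_exists.mpr ⟨ts, ts', fun t ht => ?_, rfl, ?_, ?_⟩
    · obtain ⟨t', h, h'⟩ := key t (by
        rw [← List.map_append]
        exact List.mem_map_of_mem ht)
      rwa [← Subtype.ext h']
    · refine Subtype.ext ((hcoe _).trans ?_)
      rw [List.map_append]
      exact hprod
    · rw [hlenP, ← hlen]
      simp

end CoxeterSystem

namespace CoxeterMatrix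

variable {B : Type*} [Fintype B] [DecidableEq B] (M : CoxeterMatrix B)

/-- Words up to rotation and exchange of adjacent letters with orthogonal simple roots. -/
inductive WordEquiv : List B → List B → Prop
  | refl (l : List B) : WordEquiv l l
  | symm {l l' : List B} : WordEquiv l l' → WordEquiv l' l
  | trans {l l' l'' : List B} : WordEquiv l l' → WordEquiv l' l'' → WordEquiv l l''
  | swap (a : List B) (i j : B) (b : List B) (h : M.cosForm (simpleRoot i) (simpleRoot j) = 0) :
      WordEquiv (a ++ i :: j :: b) (a ++ j :: i :: b)
  | rotate (i : B) (l : List B) : WordEquiv (i :: l) (l ++ [i])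

namespace WordEquiv

variable {M}

theorem perm {l l' : List B} (h : M.WordEquiv l l') : l.Perm l' := by
  induction h with
  | refl l => exact List.Perm.refl l
  | symm _ ih => exact ih.symm
  | trans _ _ ih ih' => exact ih.trans ih'
  | swap a i j b _ => exact (List.Perm.swap j i b).append_left a
  | rotate i l => exact (List.perm_append_singleton i l).symm

theorem append_comm (a b : List B) : M.WordEquiv (a ++ b) (b ++ a) := by
  induction a generalizing b with
  | nil => simpa using refl b
  | cons i a ih =>
    have h := (rotate (M := M) i (a ++ b)).trans (by simpa using ih (b ++ [i]))
    simpa using h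

theorem move {i : B} {v : List B}
    (hv : ∀ y ∈ v, M.cosForm (simpleRoot i) (simpleRoot y) = 0) (a : List B) :
    M.WordEquiv (a ++ i :: v) (a ++ v ++ [i]) := by
  induction v generalizing a with
  | nil => simpa using refl _
  | cons y v ih =>
    simp only [List.mem_cons, forall_eq_or_imp] at hv
    exact (swap a i y v hv.1).trans (by simpa using ih hv.2 (a ++ [y]))

theorem cons {u u' : List B} (h : M.WordEquiv u u') {i : B} (hu : u.Nodup)
    (hi : ∀ j ∈ u, ∀ k ∈ u, M.cosForm (simpleRoot i) (simpleRoot j) ≠ 0 →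
      M.cosForm (simpleRoot i) (simpleRoot k) ≠ 0 → j = k) :
    M.WordEquiv (i :: u) (i :: u') := by
  induction h with
  | refl l => exact refl _
  | symm h ih =>
    refine (ih (h.perm.nodup_iff.mpr hu) fun j hj k hk => ?_).symm
    exact hi j (h.perm.mem_iff.mp hj) k (h.perm.mem_iff.mp hk)
  | trans h _ ih ih' =>
    refine (ih hu hi).trans (ih' (h.perm.nodup_iff.mp hu) fun j hj k hk => ?_)
    exact hi j (h.perm.mem_iff.mpr hj) k (h.perm.mem_iff.mpr hk)
  | swap a x y b h => exact swap (i :: a) x y b h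
  | rotate x v =>
    by_cases hx : M.cosForm (simpleRoot i) (simpleRoot x) = 0
    · exact (swap [] i x v hx).trans (rotate x (i :: v))
    · have hv : ∀ y ∈ v, M.cosForm (simpleRoot i) (simpleRoot y) = 0 := by
        intro y hy
        by_contra hne
        have := hi x List.mem_cons_self y (List.mem_cons_of_mem _ hy) hx hne
        exact (List.nodup_cons.mp hu).1 (this ▸ hy)
      refine (rotate i (x :: v)).trans (WordEquiv.trans ?_ (rotate x (i :: v)))
      exact (move hv [x]).symm

end WordEquiv

end CoxeterMatrix

namespace CoxeterSystem

variable {B : Type*} [Fintype B] [DecidableEq B] {W : Type*} [Group W] {M : CoxeterMatrix B}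
  (cs : CoxeterSystem M W)

theorem commute_of_cosForm_eq_zero [Finite W] {i j : B}
    (h : M.cosForm (simpleRoot i) (simpleRoot j) = 0) : Commute (cs.simple i) (cs.simple j) := by
  refine cs.geomRep_injective (LinearMap.ext fun x => ?_)
  rw [geomRep_mul_apply, geomRep_mul_apply]
  have h' := h
  rw [cosForm_comm] at h'
  simp only [geomRep_simple, rootReflection_apply, map_sub, map_smul, h, h', sub_zero, mul_zero,
    zero_smul]
  abel

theorem isConj_of_wordEquiv [Finite W] {l l' : List B} (h : M.WordEquiv l l') :
    IsConj (cs.wordProd l) (cs.wordProd l') := by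
  induction h with
  | refl l => exact IsConj.refl _
  | symm _ ih => exact ih.symm
  | trans _ _ ih ih' => exact ih.trans ih'
  | swap a i j b h =>
    have hcomm := (cs.commute_of_cosForm_eq_zero h).eq
    rw [wordProd_append, wordProd_append, wordProd_cons, wordProd_cons, wordProd_cons,
      wordProd_cons, ← mul_assoc (cs.simple i), hcomm, mul_assoc (cs.simple j)]
  | rotate i l =>
    rw [wordProd_cons, wordProd_append, wordProd_singleton]
    exact isConj_iff.mpr ⟨cs.wordProd l, by group⟩

variable [Finite W]

theorem cosForm_simpleRoot_eq_zero_or (cs : CoxeterSystem M W) {i j : B} (hij : i ≠ j) :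
    M.cosForm (simpleRoot i) (simpleRoot j) = 0 ∨
      M.cosForm (simpleRoot i) (simpleRoot j) ≤ -1 / 2 := by
  have h0 := cs.coxeterMatrix_ne_zero i j
  have h1 := M.off_diagonal i j hij
  rw [cosForm_simpleRoot]
  rcases (show M i j = 2 ∨ 3 ≤ M i j by omega) with h | h
  · left
    rw [h]
    simp
  · right
    have h3 : (3 : ℝ) ≤ M i j := by exact_mod_cast h
    have hle : Real.pi / M i j ≤ Real.pi / 3 :=
      div_le_div_of_nonneg_left Real.pi_pos.le (by norm_num) h3
    have := Real.cos_le_cos_of_nonneg_of_le_pi (by positivity)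
      (by linarith [Real.pi_pos] : Real.pi / 3 ≤ Real.pi) hle
    rw [Real.cos_pi_div_three] at this
    linarith

theorem cosForm_simpleRoot_nonpos (cs : CoxeterSystem M W) {i j : B} (hij : i ≠ j) :
    M.cosForm (simpleRoot i) (simpleRoot j) ≤ 0 := by
  rcases cs.cosForm_simpleRoot_eq_zero_or hij with h | h <;> linarith

/-- The Coxeter graph of a finite Coxeter group is a forest: every nonempty set of vertices contains
one with at most one neighbour in the set. -/
theorem exists_leaf (cs : CoxeterSystem M W) {J : Finset B} (hJ : J.Nonempty) :
    ∃ i ∈ J, ∀ j ∈ J, ∀ k ∈ J, j ≠ i → k ≠ i → M.cosForm (simpleRoot i) (simpleRoot j) ≠ 0 →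
      M.cosForm (simpleRoot i) (simpleRoot k) ≠ 0 → j = k := by
  by_contra! hne
  have hv : ∑ i ∈ J, simpleRoot i ≠ 0 := by
    obtain ⟨i, hi⟩ := hJ
    intro h
    have := congrFun h i
    simp [simpleRoot, Finset.sum_apply, Pi.single_apply, hi] at this
  refine (cs.cosForm_pos hv).not_ge ?_
  rw [map_sum M.cosForm, LinearMap.sum_apply]
  refine Finset.sum_nonpos fun i hi => ?_
  obtain ⟨j, hj, k, hk, hji, hki, hj0, hk0, hjk⟩ := hne i hi
  rw [map_sum]
  have hsub : ({i, j, k} : Finset B) ⊆ J := by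
    intro x
    simp only [Finset.mem_insert, Finset.mem_singleton]
    rintro (rfl | rfl | rfl) <;> assumption
  rw [← Finset.sum_sdiff hsub, Finset.sum_insert (by simp [hji.symm, hki.symm]),
    Finset.sum_pair hjk, cosForm_simpleRoot_self]
  have h1 := (cs.cosForm_simpleRoot_eq_zero_or hji.symm).resolve_left hj0
  have h2 := (cs.cosForm_simpleRoot_eq_zero_or hki.symm).resolve_left hk0
  have h3 : ∑ x ∈ J \ {i, j, k}, M.cosForm (simpleRoot i) (simpleRoot x) ≤ 0 := by
    refine Finset.sum_nonpos fun x hx => cs.cosForm_simpleRoot_nonpos ?_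
    rintro rfl
    simp at hx
  linarith

theorem wordEquiv_of_perm (cs : CoxeterSystem M W) {l l' : List B} (hl : l.Nodup)
    (h : l.Perm l') : M.WordEquiv l l' := by
  induction hn : l.length generalizing l l' with
  | zero =>
    obtain rfl := List.length_eq_zero_iff.mp hn
    obtain rfl := h.nil_eq
    exact .refl _
  | succ n ih =>
    obtain ⟨i, hi, hleaf⟩ := cs.exists_leaf (J := l.toFinset) (by
      rw [List.toFinset_nonempty_iff]
      rintro rfl
      simp at hn)
    rw [List.mem_toFinset] at hi
    obtain ⟨a, b, rfl⟩ := List.append_of_mem hi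
    obtain ⟨a', b', rfl⟩ := List.append_of_mem (h.mem_iff.mp hi)
    have h1 : (i :: (b ++ a)).Perm (a ++ i :: b) :=
      (WordEquiv.append_comm (M := M) (i :: b) a).perm
    have h2 : (i :: (b' ++ a')).Perm (a' ++ i :: b') :=
      (WordEquiv.append_comm (M := M) (i :: b') a').perm
    have hnd := h1.nodup_iff.mpr hl
    rw [List.nodup_cons] at hnd
    have h3 := ih hnd.2 ((h1.trans (h.trans h2.symm)).cons_inv) (by
      have := h1.length_eq
      simp only [List.length_cons] at this
      omega)
    refine (WordEquiv.append_comm a (i :: b)).trans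
      (.trans ?_ (WordEquiv.append_comm (i :: b') a'))
    have hmem (j) (hj : j ∈ b ++ a) : j ∈ (a ++ i :: b).toFinset ∧ j ≠ i := by
      refine ⟨?_, ne_of_mem_of_not_mem hj hnd.1⟩
      rw [List.mem_toFinset, ← h1.mem_iff]
      exact List.mem_cons_of_mem _ hj
    exact h3.cons hnd.2 fun j hj k hk =>
      hleaf j (hmem j hj).1 k (hmem k hk).1 (hmem j hj).2 (hmem k hk).2

/-- Any two Coxeter elements are conjugate. -/
theorem isConj_wordProd_of_perm {l l' : List B} (hl : l.Nodup) (h : l.Perm l') :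
    IsConj (cs.wordProd l) (cs.wordProd l') :=
  cs.isConj_of_wordEquiv (cs.wordEquiv_of_perm hl h)

/-- The Coxeter graph of a finite Coxeter group is bipartite. -/
theorem exists_coloring (cs : CoxeterSystem M W) (i₀ : B) : ∃ f : B → Bool, f i₀ = true ∧
    ∀ i j, i ≠ j → f i = f j → M.cosForm (simpleRoot i) (simpleRoot j) = 0 := by
  have key (n : ℕ) : ∀ J : Finset B, J.card = n → ∃ f : B → Bool, ∀ i ∈ J, ∀ j ∈ J, i ≠ j →
      f i = f j → M.cosForm (simpleRoot i) (simpleRoot j) = 0 := by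
    induction n with
    | zero =>
      intro J hJ
      obtain rfl := Finset.card_eq_zero.mp hJ
      exact ⟨fun _ => false, by simp⟩
    | succ n ih =>
      intro J hJ
      obtain ⟨i, hi, hleaf⟩ := cs.exists_leaf (J := J) (Finset.card_pos.mp (by omega))
      obtain ⟨f, hf⟩ := ih (J.erase i) (by rw [Finset.card_erase_of_mem hi]; omega)
      obtain ⟨b, hb⟩ : ∃ b : Bool, ∀ j ∈ J, j ≠ i → f j = b →
          M.cosForm (simpleRoot i) (simpleRoot j) = 0 := by
        by_contra! hne
        obtain ⟨j, hj, hji, hjb, hj0⟩ := hne true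
        obtain ⟨k, hk, hki, hkb, hk0⟩ := hne false
        have := hleaf j hj k hk hji hki hj0 hk0
        rw [this, hkb] at hjb
        exact Bool.false_ne_true hjb
      refine ⟨Function.update f i b, fun j hj k hk hjk hfjk => ?_⟩
      by_cases hji : j = i
      · subst hji
        rw [Function.update_self, Function.update_of_ne hjk.symm] at hfjk
        exact hb k hk hjk.symm hfjk.symm
      · rw [Function.update_of_ne hji] at hfjk
        by_cases hki : k = i
        · subst hki
          rw [Function.update_self] at hfjk
          rw [cosForm_comm]
          exact hb j hj hji hfjk
        · rw [Function.update_of_ne hki] at hfjk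
          exact hf j (Finset.mem_erase.mpr ⟨hji, hj⟩) k (Finset.mem_erase.mpr ⟨hki, hk⟩) hjk hfjk
  obtain ⟨f, hf⟩ := key _ Finset.univ rfl
  refine ⟨fun i => xor (f i) (!f i₀), by simp, fun i j hij h => ?_⟩
  exact hf i (Finset.mem_univ i) j (Finset.mem_univ j) hij (by simpa using h)

end CoxeterSystem

namespace CoxeterSystem

variable {B : Type*} [Fintype B] [DecidableEq B] {W : Type*} [Group W] {M : CoxeterMatrix B}
  [Finite W]

theorem cosForm_abs_le (cs : CoxeterSystem M W) (x : B → ℝ) :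
    M.cosForm |x| |x| ≤ M.cosForm x x := by
  rw [cosForm_eq_sum, cosForm_eq_sum]
  refine Finset.sum_le_sum fun i _ => Finset.sum_le_sum fun j _ => ?_
  by_cases hij : i = j
  · subst hij
    simp
  · have h := cs.cosForm_simpleRoot_nonpos hij
    have h2 : x i * x j ≤ |x| i * |x| j := by
      simpa [abs_mul] using le_abs_self (x i * x j)
    nlinarith

/-- The minimal eigenvalue of the form is attained at a nonnegative vector. -/
theorem exists_nonneg_eigenvector [Nonempty B] (cs : CoxeterSystem M W) :
    ∃ u : B → ℝ, ∃ μ : ℝ, u ≠ 0 ∧ 0 ≤ u ∧ ∀ i, M.cosForm u (simpleRoot i) = μ * u i := by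
  let K : Set (B → ℝ) := {x | ∑ i, x i ^ 2 = 1}
  have hK : IsCompact K := by
    refine Metric.isCompact_of_isClosed_isBounded
      (isClosed_eq (by fun_prop) continuous_const) ?_
    refine (Metric.isBounded_closedBall (x := (0 : B → ℝ)) (r := 1)).subset fun x hx => ?_
    rw [mem_closedBall_zero_iff, pi_norm_le_iff_of_nonneg zero_le_one]
    intro i
    rw [Real.norm_eq_abs, ← sq_le_one_iff_abs_le_one]
    rw [← (show ∑ i, x i ^ 2 = 1 from hx)]
    exact Finset.single_le_sum (f := fun i => x i ^ 2) (fun j _ => sq_nonneg _)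
      (Finset.mem_univ i)
  have hKne : K.Nonempty := by
    obtain ⟨i⟩ := ‹Nonempty B›
    exact ⟨Pi.single i 1, by simp [K, Pi.single_apply]⟩
  obtain ⟨x, hxK, hmin⟩ := hK.exists_isMinOn hKne
    (f := fun x => M.cosForm x x) (by
      rw [funext fun x => cosForm_eq_sum (M := M) x x]
      fun_prop)
  set u : B → ℝ := |x| with hu
  have huK : ∑ i, u i ^ 2 = 1 := by simpa [hu, K] using hxK
  set μ := M.cosForm u u with hμ
  have hle (y : B → ℝ) : μ * ∑ i, y i ^ 2 ≤ M.cosForm y y := by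
    by_cases hy : y = 0
    · simp [hy]
    have hpos : 0 < ∑ i, y i ^ 2 := by
      refine lt_of_le_of_ne (Finset.sum_nonneg fun i _ => sq_nonneg _) fun h => hy ?_
      ext i
      have := (Finset.sum_eq_zero_iff_of_nonneg fun i _ => sq_nonneg (y i)).mp h.symm i
        (Finset.mem_univ i)
      simpa using this
    set r := Real.sqrt (∑ i, y i ^ 2) with hr
    have hr2 : r ^ 2 = ∑ i, y i ^ 2 := Real.sq_sqrt hpos.le
    have hr0 : 0 < r := Real.sqrt_pos.mpr hpos
    have hyK : r⁻¹ • y ∈ K := by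
      simp only [K, Set.mem_ofPred_eq, Pi.smul_apply, smul_eq_mul, mul_pow, ← Finset.mul_sum, ← hr2]
      field_simp
    have h1 := (cs.cosForm_abs_le x).trans (hmin hyK)
    simp only [map_smul, LinearMap.smul_apply, smul_eq_mul] at h1
    rw [← hr2]
    calc μ * r ^ 2 ≤ (r⁻¹ * (r⁻¹ * M.cosForm y y)) * r ^ 2 := by gcongr
      _ = M.cosForm y y := by field_simp
  refine ⟨u, μ, fun h => by simp [h] at huK, abs_nonneg x, fun i => ?_⟩
  have key (t : ℝ) : 0 ≤ t * (2 * (M.cosForm u (simpleRoot i) - μ * u i)) + t ^ 2 * (1 - μ) := by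
    have h := hle (u + t • simpleRoot i)
    have h1 : ∑ j, (u + t • simpleRoot i) j ^ 2 = 1 + 2 * t * u i + t ^ 2 := by
      simp only [simpleRoot, Pi.add_apply, Pi.smul_apply, Pi.single_apply, smul_eq_mul, mul_ite,
        mul_one, mul_zero, add_sq, Finset.sum_add_distrib, huK]
      simp
      ring
    rw [h1] at h
    simp only [map_add, map_smul, LinearMap.add_apply, LinearMap.smul_apply, smul_eq_mul,
      cosForm_simpleRoot_self, M.cosForm_comm (simpleRoot i) u, ← hμ] at h
    linarith
  have h1 := discrim_le_zero (a := 1 - μ) (b := 2 * (M.cosForm u (simpleRoot i) - μ * u i))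
    (c := 0) fun t => by
      have := key t
      linarith
  rw [discrim] at h1
  have h2 : M.cosForm u (simpleRoot i) - μ * u i = 0 := by
    rw [← sq_eq_zero_iff]
    nlinarith [sq_nonneg (M.cosForm u (simpleRoot i) - μ * u i)]
  linarith

/-- The Perron eigenvector of an irreducible finite Coxeter group. -/
theorem exists_pos_eigenvector (cs : CoxeterSystem M W) (hirr : IsIrreducibleCS cs) :
    ∃ u : B → ℝ, ∃ μ : ℝ, (∀ i, 0 < u i) ∧ ∀ i, M.cosForm u (simpleRoot i) = μ * u i := by
  have := hirr.1
  obtain ⟨u, μ, hu0, hu, heig⟩ := cs.exists_nonneg_eigenvector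
  refine ⟨u, μ, fun i => ?_, heig⟩
  have hcomm (a b : B) (ha' : u a = 0) (hb : u b ≠ 0) :
      Commute (cs.simple a) (cs.simple b) := by
    apply cs.commute_of_cosForm_eq_zero
    have h1 := heig a
    rw [ha', mul_zero, eq_sum_smul_simpleRoot u, map_sum, LinearMap.sum_apply] at h1
    have h2 := (Finset.sum_eq_zero_iff_of_nonpos fun j _ => ?_).mp h1 b (Finset.mem_univ b)
    · rw [map_smul, LinearMap.smul_apply, smul_eq_mul] at h2
      rw [cosForm_comm]
      exact (mul_eq_zero.mp h2).resolve_left hb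
    · rw [map_smul, LinearMap.smul_apply, smul_eq_mul]
      by_cases hja : j = a
      · simp [hja, ha']
      · exact mul_nonpos_of_nonneg_of_nonpos (hu j) (cs.cosForm_simpleRoot_nonpos hja)
  rcases hirr.2 {i | u i = 0} fun a ha b hb => hcomm a b ha hb with h | h
  · refine lt_of_le_of_ne (hu i) fun hi => ?_
    have : i ∈ {i | u i = 0} := hi.symm
    simp [h] at this
  · refine absurd (funext fun i => ?_) hu0
    have : i ∈ {i | u i = 0} := by simp [h]
    exact this

end CoxeterSystem

section Recurrence

/-- Solutions of `e (n + 2) = κ * e (n + 1) - e n`. -/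
def IsRecurrent (κ : ℝ) (e : ℕ → ℝ) : Prop := ∀ n, e (n + 2) = κ * e (n + 1) - e n

/-- Consecutive terms have the same sign and do not both vanish. -/
def IsSignCoherent (e : ℕ → ℝ) : Prop := ∀ n,
  (0 ≤ e n ∧ 0 ≤ e (n + 1) ∧ 0 < e n + e (n + 1)) ∨
    (e n ≤ 0 ∧ e (n + 1) ≤ 0 ∧ e n + e (n + 1) < 0)

variable {κ : ℝ} {b e : ℕ → ℝ}

theorem IsRecurrent.eq_combination (hb : IsRecurrent κ b) (hb0 : b 0 = 0) (hb1 : b 1 = 1)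
    (he : IsRecurrent κ e) (n j : ℕ) : e (n + j + 1) = b (j + 1) * e (n + 1) - b j * e n := by
  induction j using Nat.twoStepInduction with
  | zero => simp [hb0, hb1]
  | one =>
    have := he n
    have h2 := hb 0
    simp only [zero_add, hb0, hb1] at h2
    rw [show n + 1 + 1 = n + 2 from rfl, this, h2, hb1]
    ring
  | more j ih1 ih2 =>
    have h1 := he (n + j + 1)
    have h2 := hb (j + 1)
    have h3 := hb j
    rw [show n + (j + 2) + 1 = n + j + 1 + 2 by ring, h1, ih1,
      show n + j + 1 + 1 = n + (j + 1) + 1 by ring, ih2, show j + 2 + 1 = j + 1 + 2 by ring, h2,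
      show j + 1 + 1 = j + 2 from rfl, h3]
    ring

theorem IsRecurrent.sq_sub_mul (hb : IsRecurrent κ b) (hb0 : b 0 = 0) (hb1 : b 1 = 1) (n : ℕ) :
    b (n + 1) ^ 2 - b n * b (n + 2) = 1 := by
  induction n with
  | zero => simp [hb0, hb1]
  | succ n ih =>
    have h1 := hb (n + 1)
    have h2 := hb n
    rw [h1, ← ih, show n + 1 + 1 = n + 2 from rfl, h2]
    ring

/-- A sign-coherent recurrent sequence starting with `0, 1` and having another zero is positive up
to its first zero, and has that zero as antiperiod. -/
theorem IsRecurrent.exists_antiperiod (hb : IsRecurrent κ b) (hb0 : b 0 = 0) (hb1 : b 1 = 1)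
    (hs : IsSignCoherent b) {N : ℕ} (hN : 0 < N) (hbN : b N = 0) :
    ∃ m, 2 ≤ m ∧ (∀ n, 0 < n → n < m → 0 < b n) ∧ b m = 0 ∧
      ∀ e, IsRecurrent κ e → ∀ n, e (n + m) = -e n := by
  classical
  have hex : ∃ m, 0 < m ∧ b m = 0 := ⟨N, hN, hbN⟩
  obtain ⟨hm0, hm⟩ := Nat.find_spec hex
  have hmin (n) (h : n < Nat.find hex) := Nat.find_min hex h
  set m := Nat.find hex
  have hm1 : m ≠ 1 := by
    intro h
    rw [h, hb1] at hm
    exact one_ne_zero hm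
  have hpos (n) (h0 : 0 < n) : n < m → 0 < b n := by
    induction n, h0 using Nat.le_induction with
    | base => intro; simp [hb1]
    | succ n h0 ih =>
      intro h
      have h1 := ih (by omega)
      have h2 : b (n + 1) ≠ 0 := fun h3 => hmin _ h ⟨by omega, h3⟩
      rcases hs n with h3 | h3
      · exact lt_of_le_of_ne h3.2.1 h2.symm
      · linarith [h3.1]
  obtain ⟨k, hk⟩ : ∃ k, m = k + 2 := ⟨m - 2, by omega⟩
  have hk1 : b (k + 1) = 1 := by
    have h1 := hb.sq_sub_mul hb0 hb1 k
    rw [← hk, hm] at h1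
    have h2 := hpos (k + 1) (by omega) (by omega)
    nlinarith
  refine ⟨m, by omega, hpos, hm, fun e he n => ?_⟩
  have h1 := hb.eq_combination hb0 hb1 he n (k + 1)
  rw [show k + 1 + 1 = m from hk.symm, hm, hk1] at h1
  rw [hk, show n + (k + 2) = n + (k + 1) + 1 by ring, h1]
  ring

/-- Up to a shift, the signs of a sign-coherent antiperiodic sequence are as for `b`. -/
theorem IsRecurrent.exists_shift (hb : IsRecurrent κ b) (hb0 : b 0 = 0) (hb1 : b 1 = 1)
    {m : ℕ} (hpos : ∀ n, 0 < n → n < m → 0 < b n) (hbm : b m = 0)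
    (hanti : ∀ e, IsRecurrent κ e → ∀ n, e (n + m) = -e n)
    (he : IsRecurrent κ e) (hs : IsSignCoherent e) :
    ∃ n, ∀ j, (j < m → 0 < e (n + j) + e (n + j + 1)) ∧
      (m ≤ j → j < 2 * m → e (n + j) + e (n + j + 1) < 0) := by
  obtain ⟨n, hn0, hn1⟩ : ∃ n, e n = 0 ∧ 0 < e (n + 1) := by
    by_contra! hne
    have hstep (n) (h : e n ≤ 0) : e (n + 1) ≤ 0 := by
      rcases hs n with h1 | h1
      · exact hne n (le_antisymm h h1.1)
      · exact h1.2.1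
    have hstep' (n k) (h : e n ≤ 0) : e (n + k) ≤ 0 := by
      induction k with
      | zero => exact h
      | succ k ih => exact hstep _ ih
    have hneg (n) (h : e n < 0) : False := by
      have h1 := hstep' n m h.le
      rw [hanti e he] at h1
      linarith
    have hzero (n) : e n = 0 := by
      rcases lt_trichotomy (e n) 0 with h | h | h
      · exact (hneg n h).elim
      · exact h
      · exact (hneg (n + m) (by rw [hanti e he]; linarith)).elim
    have := hs 0
    simp [hzero] at this
  have hcomb (j) : e (n + j) = b j * e (n + 1) := by
    rcases j with _ | j
    · simp [hn0, hb0]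
    · rw [← add_assoc, hb.eq_combination hb0 hb1 he n j, hn0, mul_zero, sub_zero]
  have hb' (j) (h : j < m) : 0 < b j + b (j + 1) := by
    rcases Nat.eq_zero_or_pos j with rfl | h0
    · simp [hb0, hb1]
    · have h1 := hpos j h0 h
      rcases (show j + 1 = m ∨ j + 1 < m by omega) with h2 | h2
      · rw [h2, hbm, add_zero]
        exact h1
      · linarith [hpos (j + 1) (by omega) h2]
  refine ⟨n, fun j => ⟨fun hj => ?_, fun hj hj' => ?_⟩⟩
  · rw [add_assoc, hcomb j, hcomb (j + 1), ← add_mul]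
    exact mul_pos (hb' j hj) hn1
  · obtain ⟨i, rfl⟩ := Nat.exists_eq_add_of_le' hj
    have h1 := hb' i (by omega)
    rw [add_assoc, hcomb (i + m), hcomb (i + m + 1), ← add_mul, show i + m + 1 = i + 1 + m by ring,
      hanti b hb,
      hanti b hb]
    nlinarith

end Recurrence

namespace CoxeterSystem

variable {B : Type*} [Fintype B] [DecidableEq B] {W : Type*} [Group W] {M : CoxeterMatrix B}
  (cs : CoxeterSystem M W)

theorem geomRep_wordProd_of_orthogonal {l : List B} (hl : l.Nodup)
    (horth : ∀ i ∈ l, ∀ j ∈ l, i ≠ j → M.cosForm (simpleRoot i) (simpleRoot j) = 0)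
    (x : B → ℝ) : cs.geomRep (cs.wordProd l) x =
      x - ∑ i ∈ l.toFinset, (2 * M.cosForm x (simpleRoot i)) • simpleRoot i := by
  induction l with
  | nil => simp
  | cons i l ih =>
    obtain ⟨hi, hl⟩ := List.nodup_cons.mp hl
    have h1 : M.cosForm (∑ j ∈ l.toFinset, (2 * M.cosForm x (simpleRoot j)) • simpleRoot j)
        (simpleRoot i) = 0 := by
      rw [map_sum, LinearMap.sum_apply]
      refine Finset.sum_eq_zero fun j hj => ?_
      rw [List.mem_toFinset] at hj
      rw [map_smul, LinearMap.smul_apply, horth j (List.mem_cons_of_mem _ hj) i List.mem_cons_self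
        (ne_of_mem_of_not_mem hj hi), smul_zero]
    rw [wordProd_cons, geomRep_mul_apply, ih hl fun j hj k hk =>
      horth j (List.mem_cons_of_mem _ hj) k (List.mem_cons_of_mem _ hk), geomRep_simple,
      rootReflection_apply, map_sub, LinearMap.sub_apply, h1, List.toFinset_cons,
      Finset.sum_insert (by simpa using hi), sub_zero]
    abel

/-- The letters of a given colour. -/
noncomputable def colorWord (f : B → Bool) (b : Bool) : List B :=
  (Finset.univ.filter fun i => f i = b).toList

theorem mem_colorWord {f : B → Bool} {b : Bool} {i : B} : i ∈ colorWord f b ↔ f i = b := by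
  simp [colorWord]

theorem nodup_colorWord (f : B → Bool) (b : Bool) : (colorWord f b).Nodup := Finset.nodup_toList _

theorem nodup_bipartite (f : B → Bool) : (colorWord f true ++ colorWord f false).Nodup := by
  refine List.Nodup.append (nodup_colorWord _ _) (nodup_colorWord _ _) fun i h h' => ?_
  rw [mem_colorWord] at h h'
  exact Bool.false_ne_true (h'.symm.trans h)

theorem mem_bipartite (f : B → Bool) (i : B) : i ∈ colorWord f true ++ colorWord f false := by
  rw [List.mem_append, mem_colorWord, mem_colorWord]
  exact Bool.eq_false_or_eq_true (f i)

theorem geomRep_colorWord {f : B → Bool}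
    (hf : ∀ i j, i ≠ j → f i = f j → M.cosForm (simpleRoot i) (simpleRoot j) = 0) (b : Bool)
    (x : B → ℝ) : cs.geomRep (cs.wordProd (colorWord f b)) x =
      x - ∑ i with f i = b, (2 * M.cosForm x (simpleRoot i)) • simpleRoot i := by
  rw [cs.geomRep_wordProd_of_orthogonal (nodup_colorWord f b), colorWord, Finset.toList_toFinset]
  intro i hi j hj hij
  rw [mem_colorWord] at hi hj
  exact hf i j hij (hi.trans hj.symm)

/-- The sum of the coordinates of a given colour with weights `u`. -/
def colorSum (f : B → Bool) (u : B → ℝ) (b : Bool) (x : B → ℝ) : ℝ := ∑ i with f i = b, u i * x i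

theorem colorSum_add (f : B → Bool) (u : B → ℝ) (b : Bool) (x : B → ℝ) :
    colorSum f u b x + colorSum f u (!b) x = ∑ i, u i * x i := by
  rw [colorSum, colorSum, ← Finset.sum_filter_add_sum_filter_not Finset.univ (fun i => f i = b)]
  congr 2
  ext i
  cases f i <;> cases b <;> simp

theorem geomRep_colorWord_apply_of_ne {f : B → Bool} {b : Bool} (x : B → ℝ) {i : B}
    (hi : f i ≠ b) : cs.geomRep (cs.wordProd (colorWord f b)) x i = x i := by
  have h := mem_rootSpan_iff.mp (cs.geomRep_wordProd_sub_mem (colorWord f b) x) i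
    (by simpa [mem_colorWord] using hi)
  exact sub_eq_zero.mp h

theorem colorSum_not_geomRep (f : B → Bool) (u : B → ℝ) (b : Bool) (x : B → ℝ) :
    colorSum f u (!b) (cs.geomRep (cs.wordProd (colorWord f b)) x) = colorSum f u (!b) x := by
  refine Finset.sum_congr rfl fun i hi => ?_
  rw [cs.geomRep_colorWord_apply_of_ne]
  rw [(Finset.mem_filter.mp hi).2]
  exact Bool.not_ne_self b

theorem colorSum_geomRep {f : B → Bool}
    (hf : ∀ i j, i ≠ j → f i = f j → M.cosForm (simpleRoot i) (simpleRoot j) = 0)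
    {u : B → ℝ} {μ : ℝ} (hu : ∀ i, M.cosForm u (simpleRoot i) = μ * u i) (b : Bool) (x : B → ℝ) :
    colorSum f u b (cs.geomRep (cs.wordProd (colorWord f b)) x) =
      2 * (1 - μ) * colorSum f u (!b) x - colorSum f u b x := by
  have hself (b : Bool) (j : B) (hj : f j = b) :
      ∑ i with f i = b, u i * M.cosForm (simpleRoot i) (simpleRoot j) = u j := by
    rw [Finset.sum_eq_single_of_mem j (by simpa using hj), cosForm_simpleRoot_self, mul_one]
    intro i hi hij
    rw [hf i j hij ((Finset.mem_filter.mp hi).2.trans hj.symm), mul_zero]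
  have hsum (j : B) : ∑ i, u i * M.cosForm (simpleRoot i) (simpleRoot j) = μ * u j := by
    rw [← hu j]
    conv_rhs => rw [eq_sum_smul_simpleRoot u]
    simp
  have hother (j : B) (hj : f j = !b) :
      ∑ i with f i = b, u i * M.cosForm (simpleRoot i) (simpleRoot j) = (μ - 1) * u j := by
    have h1 := hsum j
    have h2 := colorSum_add f u b fun i => M.cosForm (simpleRoot i) (simpleRoot j)
    rw [h1] at h2
    simp only [colorSum] at h2
    rw [hself _ j hj] at h2
    linarith
  have hx : ∑ i with f i = b, u i * M.cosForm x (simpleRoot i) =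
      colorSum f u b x + (μ - 1) * colorSum f u (!b) x := by
    have h1 (i : B) : M.cosForm x (simpleRoot i) =
        ∑ j, x j * M.cosForm (simpleRoot i) (simpleRoot j) := by
      rw [cosForm_comm]
      conv_lhs => rw [eq_sum_smul_simpleRoot x]
      simp
    have h2 : ∑ i with f i = b, u i * M.cosForm x (simpleRoot i) =
        ∑ j, x j * ∑ i with f i = b, u i * M.cosForm (simpleRoot i) (simpleRoot j) := by
      simp only [h1, Finset.mul_sum]
      rw [Finset.sum_comm]
      exact Finset.sum_congr rfl fun j _ => Finset.sum_congr rfl fun i _ => by ring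
    have h3 := colorSum_add f (fun j =>
      ∑ i with f i = b, u i * M.cosForm (simpleRoot i) (simpleRoot j)) b x
    rw [h2]
    simp only [mul_comm (x _)]
    rw [← h3, colorSum, colorSum, colorSum, colorSum, Finset.mul_sum]
    congr 1
    · exact Finset.sum_congr rfl fun j hj => by rw [hself b j (Finset.mem_filter.mp hj).2]
    · exact Finset.sum_congr rfl fun j hj => by
        rw [hother j (Finset.mem_filter.mp hj).2, mul_assoc]
  have hcoord (i : B) (hi : f i = b) : cs.geomRep (cs.wordProd (colorWord f b)) x i =
      x i - 2 * M.cosForm x (simpleRoot i) := by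
    rw [cs.geomRep_colorWord hf]
    simp [simpleRoot, Finset.sum_apply, Pi.single_apply, hi]
  have h4 : colorSum f u b (cs.geomRep (cs.wordProd (colorWord f b)) x) =
      colorSum f u b x - 2 * ∑ i with f i = b, u i * M.cosForm x (simpleRoot i) := by
    rw [colorSum, colorSum, Finset.mul_sum, ← Finset.sum_sub_distrib]
    refine Finset.sum_congr rfl fun i hi => ?_
    rw [hcoord i (Finset.mem_filter.mp hi).2]
    ring
  rw [h4, hx]
  ring

end CoxeterSystem

namespace CoxeterSystem

variable {B : Type*} [Fintype B] [DecidableEq B] {W : Type*} [Group W] {M : CoxeterMatrix B}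
  (cs : CoxeterSystem M W)

/-- The bipartite Coxeter element attached to a colouring. -/
noncomputable def bipartiteElement (f : B → Bool) : W :=
  cs.wordProd (colorWord f true ++ colorWord f false)

theorem bipartiteElement_eq (f : B → Bool) : cs.bipartiteElement f =
    cs.wordProd (colorWord f true) * cs.wordProd (colorWord f false) :=
  cs.wordProd_append _ _

/-- Alternating products of the two colour factors. -/
noncomputable def alternatingElement (f : B → Bool) : ℕ → W
  | 0 => 1
  | n + 1 => cs.wordProd (colorWord f n.bodd) * alternatingElement f n

theorem alternatingElement_add_two_mul (f : B → Bool) (k : ℕ) :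
    cs.alternatingElement f (2 * k) = cs.bipartiteElement f ^ k := by
  induction k with
  | zero => simp [alternatingElement]
  | succ k ih =>
    rw [mul_add, mul_one, alternatingElement, alternatingElement, ih, pow_succ',
      bipartiteElement_eq, mul_assoc]
    simp

/-- The colour sums along the alternating orbit of a vector. -/
noncomputable def orbitSeq (f : B → Bool) (u x : B → ℝ) (n : ℕ) : ℝ :=
  colorSum f u n.bodd (cs.geomRep (cs.alternatingElement f n) x)

theorem orbitSeq_succ (f : B → Bool) (u x : B → ℝ) (n : ℕ) : cs.orbitSeq f u x (n + 1) =
    colorSum f u (!n.bodd) (cs.geomRep (cs.alternatingElement f n) x) := by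
  rw [orbitSeq, alternatingElement, geomRep_mul_apply, Nat.bodd_succ, colorSum_not_geomRep]

theorem orbitSeq_add_succ (f : B → Bool) (u x : B → ℝ) (n : ℕ) :
    cs.orbitSeq f u x n + cs.orbitSeq f u x (n + 1) =
      ∑ i, u i * cs.geomRep (cs.alternatingElement f n) x i := by
  rw [orbitSeq_succ, orbitSeq, colorSum_add]

theorem isRecurrent_orbitSeq {f : B → Bool}
    (hf : ∀ i j, i ≠ j → f i = f j → M.cosForm (simpleRoot i) (simpleRoot j) = 0)
    {u : B → ℝ} {μ : ℝ} (hu : ∀ i, M.cosForm u (simpleRoot i) = μ * u i) (x : B → ℝ) :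
    IsRecurrent (2 * (1 - μ)) (cs.orbitSeq f u x) := by
  intro n
  rw [orbitSeq_succ, orbitSeq_succ, alternatingElement, geomRep_mul_apply, Nat.bodd_succ,
    Bool.not_not, cs.colorSum_geomRep hf hu, orbitSeq]

variable [Finite W]

theorem isSignCoherent_orbitSeq {f : B → Bool} {u : B → ℝ} (hu : ∀ i, 0 < u i) {β : B → ℝ}
    (hβ : cs.IsRoot β) : IsSignCoherent (cs.orbitSeq f u β) := by
  intro n
  rw [orbitSeq_add_succ, orbitSeq_succ, orbitSeq]
  have hr := hβ.geomRep (cs.alternatingElement f n)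
  set γ := cs.geomRep (cs.alternatingElement f n) β
  obtain ⟨i, hi⟩ := Function.ne_iff.mp hr.ne_zero
  rcases hr.nonneg_or_nonpos with h | h
  · refine .inl ⟨Finset.sum_nonneg fun i _ => mul_nonneg (hu i).le (h i),
      Finset.sum_nonneg fun i _ => mul_nonneg (hu i).le (h i), ?_⟩
    exact Finset.sum_pos' (fun i _ => mul_nonneg (hu i).le (h i))
      ⟨i, Finset.mem_univ i, mul_pos (hu i) (lt_of_le_of_ne (h i) hi.symm)⟩
  · refine .inr ⟨Finset.sum_nonpos fun i _ => mul_nonpos_of_nonneg_of_nonpos (hu i).le (h i),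
      Finset.sum_nonpos fun i _ => mul_nonpos_of_nonneg_of_nonpos (hu i).le (h i), ?_⟩
    exact Finset.sum_neg' (fun i _ => mul_nonpos_of_nonneg_of_nonpos (hu i).le (h i))
      ⟨i, Finset.mem_univ i, mul_neg_of_pos_of_neg (hu i) (lt_of_le_of_ne (h i) hi)⟩

theorem IsRoot.nonneg_of_sum_pos {cs : CoxeterSystem M W} {u : B → ℝ} (hu : ∀ i, 0 < u i)
    {β : B → ℝ} (hβ : cs.IsRoot β) (h : 0 < ∑ i, u i * β i) : 0 ≤ β := by
  refine hβ.nonneg_or_nonpos.resolve_right fun hneg => h.not_ge ?_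
  exact Finset.sum_nonpos fun i _ => mul_nonpos_of_nonneg_of_nonpos (hu i).le (hneg i)

theorem IsRoot.nonpos_of_sum_neg {cs : CoxeterSystem M W} {u : B → ℝ} (hu : ∀ i, 0 < u i)
    {β : B → ℝ} (hβ : cs.IsRoot β) (h : ∑ i, u i * β i < 0) : β ≤ 0 := by
  refine hβ.nonneg_or_nonpos.resolve_left fun hneg => h.not_ge ?_
  exact Finset.sum_nonneg fun i _ => mul_nonneg (hu i).le (hneg i)

/-- Along an orbit of a bipartite Coxeter element the roots are, up to a cyclic shift, first
positive and then negative. -/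
theorem exists_sign_pattern (cs : CoxeterSystem M W) (hirr : IsIrreducibleCS cs) :
    ∃ f : B → Bool,
      2 ≤ orderOf (cs.bipartiteElement f) ∧
      ∀ β, cs.IsRoot β → ∃ j ε : ℕ, ε ≤ 1 ∧ ∀ k < orderOf (cs.bipartiteElement f),
        (ε + 2 * k < orderOf (cs.bipartiteElement f) →
          0 ≤ cs.geomRep (cs.bipartiteElement f ^ (j + k)) β) ∧
        (orderOf (cs.bipartiteElement f) ≤ ε + 2 * k →
          cs.geomRep (cs.bipartiteElement f ^ (j + k)) β ≤ 0) := by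
  obtain ⟨u, μ, hu, heig⟩ := cs.exists_pos_eigenvector hirr
  obtain ⟨i₀⟩ := hirr.1
  obtain ⟨f, hi₀, hf⟩ := cs.exists_coloring i₀
  refine ⟨f, ?_⟩
  set c := cs.bipartiteElement f with hc
  have hrec := cs.isRecurrent_orbitSeq hf heig
  have hcoh {β : B → ℝ} (hβ : cs.IsRoot β) := cs.isSignCoherent_orbitSeq (f := f) hu hβ
  have h0 : cs.orbitSeq f u (simpleRoot i₀) 0 = 0 := by
    rw [orbitSeq, alternatingElement, map_one, Module.End.one_apply, colorSum]
    refine Finset.sum_eq_zero fun i hi => ?_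
    have : i ≠ i₀ := by
      rintro rfl
      exact Bool.false_ne_true ((Finset.mem_filter.mp hi).2.symm.trans hi₀)
    simp [simpleRoot, this]
  have h1 : cs.orbitSeq f u (simpleRoot i₀) 1 = u i₀ := by
    have := cs.orbitSeq_add_succ f u (simpleRoot i₀) 0
    rw [h0, alternatingElement, map_one, Module.End.one_apply, zero_add, zero_add] at this
    rw [this]
    simp [simpleRoot, Pi.single_apply]
  set b : ℕ → ℝ := fun n => cs.orbitSeq f u (simpleRoot i₀) n / u i₀ with hb
  have hbrec : IsRecurrent (2 * (1 - μ)) b := fun n => by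
    simp only [hb]
    rw [hrec]
    ring
  have hb0 : b 0 = 0 := by simp [hb, h0]
  have hb1 : b 1 = 1 := by simp [hb, h1, (hu i₀).ne']
  have hbcoh : IsSignCoherent b := fun n => by
    simp only [hb, ← add_div]
    rcases hcoh (cs.isRoot_simpleRoot i₀) n with h | h
    · exact .inl ⟨div_nonneg h.1 (hu i₀).le, div_nonneg h.2.1 (hu i₀).le, div_pos h.2.2 (hu i₀)⟩
    · exact .inr ⟨div_nonpos_of_nonpos_of_nonneg h.1 (hu i₀).le,
        div_nonpos_of_nonpos_of_nonneg h.2.1 (hu i₀).le, div_neg_of_neg_of_pos h.2.2 (hu i₀)⟩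
  have hN : 0 < orderOf c := orderOf_pos c
  have halt (k : ℕ) : cs.alternatingElement f (2 * k) = c ^ k :=
    cs.alternatingElement_add_two_mul f k
  have hbN : b (2 * orderOf c) = 0 ∧ b (2 * orderOf c + 1) = 1 := by
    rw [← hb0, ← hb1]
    simp only [hb, orbitSeq, halt, pow_orderOf_eq_one, alternatingElement]
    simp
  obtain ⟨m, hm2, hpos, hbm, hanti⟩ :=
    hbrec.exists_antiperiod hb0 hb1 hbcoh (by omega : 0 < 2 * orderOf c) hbN.1
  have hcm : c ^ m = 1 := by
    refine cs.eq_one_of_forall_nonneg fun i => ?_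
    refine ((cs.isRoot_simpleRoot i).geomRep _).nonneg_of_sum_pos hu ?_
    have h2 := cs.orbitSeq_add_succ f u (simpleRoot i) (2 * m)
    have h3 := cs.orbitSeq_add_succ f u (simpleRoot i) 0
    have h4 := hanti _ (hrec (simpleRoot i))
    have h5 := h4 0
    rw [zero_add] at h5
    rw [halt, two_mul, h4, h5, show m + m + 1 = 1 + m + m by ring, h4, h4, neg_neg, neg_neg] at h2
    rw [← h2, h3]
    simp [alternatingElement, simpleRoot, Pi.single_apply, hu i]
  have hm : m = orderOf c := by
    refine le_antisymm ?_ (orderOf_le_of_pow_eq_one (by omega) hcm)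
    by_contra! hlt
    rcases lt_trichotomy (2 * orderOf c) m with h | h | h
    · exact (hpos _ (by omega) h).ne' hbN.1
    · have h2 := hanti b hbrec 1
      rw [← h, add_comm, hbN.2, hb1] at h2
      norm_num at h2
    · obtain ⟨k, hk⟩ := Nat.exists_eq_add_of_lt h
      have h2 := hanti b hbrec (k + 1)
      rw [show k + 1 + m = 2 * orderOf c by omega, hbN.1] at h2
      have := hpos (k + 1) (by omega) (by omega)
      linarith
  rw [← hm]
  refine ⟨hm2, fun β hβ => ?_⟩
  obtain ⟨n, hn⟩ := hbrec.exists_shift hb0 hb1 hpos hbm hanti (hrec β) (hcoh hβ)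
  obtain ⟨j, ε, hε, hjn⟩ : ∃ j ε : ℕ, ε ≤ 1 ∧ 2 * j = n + ε := by
    rcases Nat.even_or_odd' n with ⟨k, h | h⟩
    · exact ⟨k, 0, by omega, by omega⟩
    · exact ⟨k + 1, 1, by omega, by omega⟩
  refine ⟨j, ε, hε, fun k hk => ?_⟩
  have h2 := cs.orbitSeq_add_succ f u β (2 * (j + k))
  rw [halt, show 2 * (j + k) = n + (ε + 2 * k) by omega] at h2
  have h3 := hn (ε + 2 * k)
  rw [h2] at h3
  have hr := hβ.geomRep (c ^ (j + k))
  exact ⟨fun h => hr.nonneg_of_sum_pos hu (h3.1 h),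
    fun h => hr.nonpos_of_sum_neg hu (h3.2 h (by omega))⟩

/-- Every orbit of roots enters the positive cone exactly once per period. -/
theorem exists_coloring_card_eq_one (cs : CoxeterSystem M W) (hirr : IsIrreducibleCS cs) :
    ∃ f : B → Bool,
      ∀ (D : Set (B → ℝ)) [DecidablePred (· ∈ D)], D = {β | cs.IsRoot β ∧ 0 ≤ β ∧
          cs.geomRep (cs.bipartiteElement f)⁻¹ β ≤ 0} →
        ∀ β, cs.IsRoot β → ((Finset.range (orderOf (cs.bipartiteElement f))).filter fun k =>
          cs.geomRep (cs.bipartiteElement f ^ k) β ∈ D).card = 1 := by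
  obtain ⟨f, h2, hsign⟩ := cs.exists_sign_pattern hirr
  refine ⟨f, ?_⟩
  rintro D _ hD β hβ
  set c := cs.bipartiteElement f
  set h := orderOf c with hh
  obtain ⟨j, ε, hε, hj⟩ := hsign β hβ
  have hper : Function.Periodic (fun k => cs.geomRep (c ^ k) β ∈ D) h := by
    intro k
    simp only [pow_add, hh, pow_orderOf_eq_one, mul_one]
  rw [← Nat.count_eq_card_filter_range, ← Nat.filter_Ico_card_eq_of_periodic j h _ hper,
    Finset.card_eq_one]
  refine ⟨j, ?_⟩
  ext n
  have hinv : cs.geomRep c⁻¹ (cs.geomRep (c ^ j) β) = cs.geomRep (c ^ (j + (h - 1))) β := by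
    rw [← geomRep_mul_apply]
    congr 2
    rw [inv_mul_eq_iff_eq_mul, ← pow_succ', show j + (h - 1) + 1 = j + h by omega, pow_add, hh,
      pow_orderOf_eq_one, mul_one]
  have hnot {γ : B → ℝ} (hγ : cs.IsRoot γ) (h1 : 0 ≤ γ) (h2 : γ ≤ 0) : False :=
    hγ.ne_zero (le_antisymm h2 h1)
  rw [Finset.mem_filter, Finset.mem_Ico, Finset.mem_singleton, hD]
  constructor
  · rintro ⟨⟨h3, h4⟩, hr, h5, h6⟩
    obtain ⟨k, rfl⟩ := Nat.exists_eq_add_of_le h3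
    rcases k with _ | k
    · rfl
    exfalso
    have h7 := hj (k + 1) (by omega)
    have h8 := hj k (by omega)
    have h9 : cs.geomRep c⁻¹ (cs.geomRep (c ^ (j + (k + 1))) β) = cs.geomRep (c ^ (j + k)) β := by
      rw [← geomRep_mul_apply]
      congr 2
      rw [← add_assoc, pow_succ', inv_mul_cancel_left]
    rw [h9] at h6
    by_cases h10 : ε + 2 * (k + 1) < h
    · exact hnot (hβ.geomRep _) (h8.1 (by omega)) h6
    · exact hnot hr h5 (h7.2 (by omega))
  · rintro rfl
    refine ⟨⟨le_refl _, by omega⟩, hβ.geomRep _, ?_, ?_⟩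
    · simpa using (hj 0 (by omega)).1 (by omega)
    · rw [hinv]
      exact (hj (h - 1) (by omega)).2 (by omega)

end CoxeterSystem

section AbsoluteOrder

variable {G : Type*} [Group G] {S : Set G}

theorem ReflectionsGenerate.edgeCount_conj (hS : ReflectionsGenerate S) (g c : G) :
    edgeCount S (g * c * g⁻¹) = edgeCount S c := by
  refine (Nat.card_congr ?_).symm
  refine ((MulAut.conj g).toEquiv.prodCongr (MulAut.conj g).toEquiv).subtypeEquiv fun p => ?_
  simp only [MulEquiv.toEquiv_eq_coe, Equiv.prodCongr_apply, Prod.map_fst, Prod.map_snd,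
    MulEquiv.coe_toEquiv, MulAut.conj_apply, hS.absLe_conj_iff, hS.absLength_conj]

/-- If every reflection lies below `c`, then the edges of the Hasse diagram of `[1, c]` are counted
by the elements of the intervals `[1, t * c]` for all reflections `t`. -/
theorem ReflectionsGenerate.edgeCount_eq_sum [Finite G] (hS : ReflectionsGenerate S)
    [Fintype {t // IsReflectionOf S t}] (hsq : ∀ t, IsReflectionOf S t → t * t = 1) {c : G}
    (hc : ∀ t, IsReflectionOf S t → absLength S (t * c) + 1 = absLength S c) :
    edgeCount S c = ∑ t : {t // IsReflectionOf S t}, ncCount S (t * c) := by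
  simp only [ncCount]
  rw [← Nat.card_sigma]
  have hinv {t : G} (ht : IsReflectionOf S t) : t⁻¹ = t := inv_eq_of_mul_eq_one_left (hsq t ht)
  refine (Nat.card_eq_of_bijective (fun p : Σ t : {t // IsReflectionOf S t},
    {w // absLe S w (t * c)} => (⟨(p.1.1 * p.2.1 * p.1.1⁻¹, p.1.1 * p.2.1), ?_⟩ :
      {p : G × G // absLe S p.1 c ∧ absLe S p.2 c ∧ absLe S p.1 p.2 ∧
        absLength S p.2 = absLength S p.1 + 1})) ⟨?_, ?_⟩).symm
  · obtain ⟨⟨t, ht⟩, w, hw⟩ := p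
    have h1 := hc t ht
    have h2 := absLength_le_one ht
    have h3 := hS.absLength_conj t w
    have h4 : (t * w)⁻¹ * c = w⁻¹ * (t * c) := by rw [mul_inv_rev, hinv ht, mul_assoc]
    have h5 : (t * w * t⁻¹)⁻¹ * c = t * ((t * w)⁻¹ * c) := by group
    have h6 : (t * w * t⁻¹)⁻¹ * (t * w) = t := by group
    have h7 := hS.absLength_mul_le t w
    have h8 := hS.absLength_mul_le (t * w) ((t * w)⁻¹ * c)
    have h9 := hS.absLength_mul_le (t * w * t⁻¹) ((t * w * t⁻¹)⁻¹ * c)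
    have h10 := hS.absLength_mul_le t ((t * w)⁻¹ * c)
    have h11 := hS.absLength_mul_le (t * w * t⁻¹) t
    rw [mul_inv_cancel_left] at h8 h9
    rw [inv_mul_cancel_right] at h11
    simp only [absLe, h6] at hw ⊢
    rw [h5] at h9 ⊢
    rw [h4] at h8 h9 h10 ⊢
    omega
  · rintro ⟨⟨t, ht⟩, w, hw⟩ ⟨⟨t', ht'⟩, w', hw'⟩ h
    simp only [Subtype.mk.injEq, Prod.mk.injEq] at h
    obtain ⟨h1, h2⟩ := h
    rw [h2] at h1
    obtain rfl : t = t' := inv_injective (mul_left_cancel h1)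
    obtain rfl : w = w' := mul_left_cancel h2
    rfl
  · rintro ⟨⟨x, y⟩, -, h1, h2, h3⟩
    have ht : IsReflectionOf S (x⁻¹ * y) := by
      apply hS.isReflectionOf_of_absLength_eq_one
      dsimp only [absLe] at h2 h3
      omega
    obtain ⟨t, rfl⟩ : ∃ t, y = x * t := ⟨x⁻¹ * y, by group⟩
    rw [inv_mul_cancel_left] at ht
    have h4 := hsq t ht
    refine ⟨⟨⟨t, ht⟩, t * x * t⁻¹, ?_⟩, ?_⟩
    · have h5 := hc t ht
      have h6 : (t * x * t⁻¹)⁻¹ * (t * c) = (x * t)⁻¹ * c := by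
        simp only [mul_inv_rev, mul_assoc, hinv ht]
        rw [← mul_assoc t t, h4, one_mul]
      have h7 := hS.absLength_conj t x
      dsimp only [absLe] at h1 h2 h3 ⊢
      rw [h6, h7]
      omega
    · have h5 : t * (t * x * t⁻¹) = x * t := by
        rw [hinv ht, mul_assoc, ← mul_assoc, h4, one_mul]
      ext
      · simp only [h5, mul_inv_cancel_right]
      · exact h5

end AbsoluteOrder

namespace CoxeterSystem

variable {B : Type*} [Fintype B] [DecidableEq B] {W : Type*} [Group W] {M : CoxeterMatrix B}
  (cs : CoxeterSystem M W)

theorem geomRep_wordProd_simpleRoot_self {l : List B} {j : B} (hj : j ∉ l) :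
    cs.geomRep (cs.wordProd l) (simpleRoot j) j = 1 := by
  have h := mem_rootSpan_iff.mp (cs.geomRep_wordProd_sub_mem l (simpleRoot j)) j hj
  rw [Pi.sub_apply, sub_eq_zero] at h
  rw [h, simpleRoot, Pi.single_eq_same]

/-- The root obtained from the simple root `j` by applying the prefix of the word `l` preceding
`j`. -/
noncomputable def wordRoot (l : List B) (j : B) : B → ℝ :=
  cs.geomRep (cs.wordProd (l.takeWhile (· ≠ j))) (simpleRoot j)

theorem isRoot_wordRoot (l : List B) (j : B) : cs.IsRoot (cs.wordRoot l j) :=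
  ⟨_, _, rfl⟩

theorem not_mem_takeWhile_ne (l : List B) (j : B) : j ∉ l.takeWhile (· ≠ j) := by
  intro h
  simpa using List.mem_takeWhile_imp h

theorem exists_eq_takeWhile_append {l : List B} {j : B} (hj : j ∈ l) :
    ∃ b, l = l.takeWhile (· ≠ j) ++ j :: b := by
  induction l with
  | nil => simp at hj
  | cons i l ih =>
    by_cases hij : i = j
    · exact ⟨l, by simp [hij]⟩
    · obtain ⟨b, hb⟩ := ih ((List.mem_cons.mp hj).resolve_left (Ne.symm hij))
      refine ⟨b, ?_⟩
      rw [List.takeWhile_cons_of_pos (by simpa using hij), List.cons_append, ← hb]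

theorem takeWhile_ne_append_cons {a b : List B} {j : B} (hj : j ∉ a) :
    (a ++ j :: b).takeWhile (· ≠ j) = a := by
  induction a with
  | nil => simp
  | cons i a ih =>
    simp only [List.mem_cons, not_or] at hj
    rw [List.cons_append, List.takeWhile_cons_of_pos (by simpa using Ne.symm hj.1), ih hj.2]

theorem not_mem_takeWhile_ne_of_mem {l : List B} {j k : B} (h : k ∈ l.takeWhile (· ≠ j)) :
    j ∉ l.takeWhile (· ≠ k) := by
  induction l with
  | nil => simp
  | cons i l ih =>
    by_cases hij : i = j
    · simp [hij] at h
    · by_cases hik : i = k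
      · simp [hik]
      · rw [List.takeWhile_cons_of_pos (by simpa using hij)] at h
        rw [List.takeWhile_cons_of_pos (by simpa using hik)]
        simp only [List.mem_cons, not_or]
        exact ⟨Ne.symm hij, ih ((List.mem_cons.mp h).resolve_left (Ne.symm hik))⟩

theorem wordRoot_injective (l : List B) : Function.Injective (cs.wordRoot l) := by
  intro j k hjk
  by_contra hne
  have key {j k : B} (hne : j ≠ k) (h : cs.wordRoot l j = cs.wordRoot l k) :
      k ∈ l.takeWhile (· ≠ j) := by
    by_contra hk
    have h1 := cs.geomRep_wordProd_simpleRoot_self (not_mem_takeWhile_ne l k)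
    have h2 := mem_rootSpan_iff.mp
      (cs.geomRep_wordProd_sub_mem (l.takeWhile (· ≠ j)) (simpleRoot j)) k hk
    rw [Pi.sub_apply, ← wordRoot, h, wordRoot, h1] at h2
    simp [simpleRoot, Ne.symm hne] at h2
  exact not_mem_takeWhile_ne_of_mem (key hne hjk) (key (Ne.symm hne) hjk.symm)

variable [Finite W]

variable {cs} in
theorem IsRoot.exists_append_of_nonpos {β : B → ℝ} (hβ : cs.IsRoot β) (h0 : 0 ≤ β) {l : List B}
    (h : cs.geomRep (cs.wordProd l)⁻¹ β ≤ 0) :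
    ∃ a j b, l = a ++ j :: b ∧ β = cs.geomRep (cs.wordProd a) (simpleRoot j) := by
  induction l generalizing β with
  | nil => exact absurd (le_antisymm (by simpa using h) h0) hβ.ne_zero
  | cons i l ih =>
    rcases (hβ.geomRep (cs.simple i)).nonneg_or_nonpos with h1 | h1
    · obtain ⟨a, j, b, rfl, h2⟩ := ih (hβ.geomRep (cs.simple i)) h1 (by
        rwa [wordProd_cons, mul_inv_rev, inv_simple, geomRep_mul_apply] at h)
      refine ⟨i :: a, j, b, rfl, ?_⟩
      rw [wordProd_cons, geomRep_mul_apply, ← h2, ← geomRep_mul_apply, simple_mul_simple_self,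
        map_one, Module.End.one_apply]
    · exact ⟨[], i, l, rfl, by simpa using hβ.eq_simpleRoot h0 h1⟩

/-- The positive roots made negative by the inverse of a product of distinct simple reflections. -/
theorem range_wordRoot {l : List B} (hl : l.Nodup) (hmem : ∀ i, i ∈ l) :
    Set.range (cs.wordRoot l) =
      {β | cs.IsRoot β ∧ 0 ≤ β ∧ cs.geomRep (cs.wordProd l)⁻¹ β ≤ 0} := by
  ext β
  constructor
  · rintro ⟨j, rfl⟩
    obtain ⟨b, hb⟩ := exists_eq_takeWhile_append (hmem j)
    have hj := not_mem_takeWhile_ne l j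
    have hroot := cs.isRoot_wordRoot l j
    refine ⟨hroot, hroot.nonneg_or_nonpos.resolve_right fun h => ?_,
      (hroot.geomRep _).nonneg_or_nonpos.resolve_left fun h => ?_⟩
    · have h1 := h j
      rw [wordRoot, cs.geomRep_wordProd_simpleRoot_self hj] at h1
      norm_num at h1
    · have hjb : j ∉ b.reverse := by
        rw [hb] at hl
        simpa using (List.nodup_cons.mp (List.nodup_append.mp hl).2.1).1
      have h1 := h j
      have h2 : (cs.wordProd l)⁻¹ * cs.wordProd (l.takeWhile (· ≠ j)) =
          cs.wordProd b.reverse * cs.simple j := by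
        nth_rw 1 [hb]
        rw [wordProd_append, wordProd_cons, wordProd_reverse, mul_inv_rev, mul_inv_rev, inv_simple,
          inv_mul_cancel_right]
      rw [wordRoot, ← geomRep_mul_apply, h2, geomRep_mul_apply, geomRep_simple,
        M.rootReflection_self (M.cosForm_simpleRoot_self j), map_neg, Pi.neg_apply,
        cs.geomRep_wordProd_simpleRoot_self hjb] at h1
      norm_num at h1
  · rintro ⟨hβ, h0, h⟩
    obtain ⟨a, j, b, rfl, rfl⟩ := hβ.exists_append_of_nonpos h0 h
    have hj : j ∉ a := fun hja => (List.nodup_append.mp hl).2.2 j hja j List.mem_cons_self rfl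
    exact ⟨j, by rw [wordRoot, takeWhile_ne_append_cons hj]⟩

/-- The element of the group acting as the reflection in the root `β`. -/
noncomputable def rootElement (β : B → ℝ) : W :=
  Function.invFun cs.geomRep (M.rootReflection β)

theorem rootElement_eq {β : B → ℝ} {t : W} (h : cs.geomRep t = M.rootReflection β) :
    cs.rootElement β = t := by
  rw [rootElement, ← h]
  exact Function.leftInverse_invFun cs.geomRep_injective t

theorem rootElement_geomRep_simpleRoot (w : W) (i : B) :
    cs.rootElement (cs.geomRep w (simpleRoot i)) = w * cs.simple i * w⁻¹ :=
  cs.rootElement_eq (cs.geomRep_conj_simple w i)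

variable {cs} in
theorem IsRoot.rootElement_geomRep {β : B → ℝ} (hβ : cs.IsRoot β) (w : W) :
    cs.rootElement (cs.geomRep w β) = w * cs.rootElement β * w⁻¹ := by
  obtain ⟨v, i, rfl⟩ := hβ
  rw [← geomRep_mul_apply, rootElement_geomRep_simpleRoot, rootElement_geomRep_simpleRoot]
  group

variable {cs} in
theorem IsRoot.isReflectionOf_rootElement {β : B → ℝ} (hβ : cs.IsRoot β) :
    IsReflectionOf (simpleSet cs) (cs.rootElement β) := by
  obtain ⟨v, i, rfl⟩ := hβ
  rw [rootElement_geomRep_simpleRoot]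
  exact cs.isReflectionOf_iff.mpr ⟨v, i, rfl⟩

variable {cs} in
theorem IsRoot.geomRep_rootElement {β : B → ℝ} (hβ : cs.IsRoot β) :
    cs.geomRep (cs.rootElement β) = M.rootReflection β := by
  obtain ⟨v, i, rfl⟩ := hβ
  rw [rootElement_geomRep_simpleRoot, geomRep_conj_simple]

variable {cs} in
theorem IsRoot.rootElement_eq_iff {β γ : B → ℝ} (hβ : cs.IsRoot β) (hγ : cs.IsRoot γ) :
    cs.rootElement β = cs.rootElement γ ↔ β = γ ∨ β = -γ := by
  constructor
  · intro h
    have h1 : M.rootReflection β β = M.rootReflection γ β := by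
      rw [← hβ.geomRep_rootElement, h, hγ.geomRep_rootElement]
    rw [M.rootReflection_self hβ.cosForm_self, rootReflection_apply] at h1
    have h2 : β = M.cosForm β γ • γ := by
      ext i
      have h3 := congrFun h1 i
      simp only [Pi.neg_apply, Pi.sub_apply, Pi.smul_apply, smul_eq_mul] at h3 ⊢
      linarith
    have h4 : M.cosForm β γ * M.cosForm β γ = 1 := by
      have h5 := hβ.cosForm_self
      nth_rw 2 [h2] at h5
      rwa [map_smul, smul_eq_mul] at h5
    rcases mul_self_eq_one_iff.mp h4 with h5 | h5
    · exact Or.inl (by rwa [h5, one_smul] at h2)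
    · exact Or.inr (by rwa [h5, neg_one_smul] at h2)
  · rintro (rfl | rfl)
    · rfl
    · exact cs.rootElement_eq (by rw [hγ.geomRep_rootElement, rootReflection_neg])

theorem exists_rootElement_eq {t : W} (ht : IsReflectionOf (simpleSet cs) t) :
    ∃ β, cs.IsRoot β ∧ cs.rootElement β = t := by
  obtain ⟨β, hβ, h⟩ := cs.exists_root_of_isReflectionOf ht
  exact ⟨β, hβ, cs.rootElement_eq h⟩

/-- The finite set of roots. -/
noncomputable def roots : Finset (B → ℝ) := cs.finite_setOf_isRoot.toFinset

theorem mem_roots {β : B → ℝ} : β ∈ cs.roots ↔ cs.IsRoot β := by simp [roots]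

theorem sum_roots_rootElement [Fintype {t // IsReflectionOf (simpleSet cs) t}] (F : W → ℕ) :
    ∑ β ∈ cs.roots, F (cs.rootElement β) =
      2 * ∑ t : {t // IsReflectionOf (simpleSet cs) t}, F t := by
  classical
  have hmem (t : W) : t ∈ cs.roots.image cs.rootElement ↔ IsReflectionOf (simpleSet cs) t := by
    simp only [Finset.mem_image, mem_roots]
    constructor
    · rintro ⟨β, hβ, rfl⟩
      exact hβ.isReflectionOf_rootElement
    · exact cs.exists_rootElement_eq
  rw [← Finset.sum_subtype _ hmem F, Finset.mul_sum, ← Finset.sum_fiberwise_of_maps_to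
    (t := cs.roots.image cs.rootElement) fun β hβ => Finset.mem_image_of_mem _ hβ]
  refine Finset.sum_congr rfl fun t ht => ?_
  obtain ⟨γ, hγ, rfl⟩ := cs.exists_rootElement_eq ((hmem t).mp ht)
  have h : cs.roots.filter (fun β => cs.rootElement β = cs.rootElement γ) = {γ, -γ} := by
    ext β
    simp only [Finset.mem_filter, mem_roots, Finset.mem_insert, Finset.mem_singleton]
    constructor
    · rintro ⟨hβ, h⟩
      exact (hβ.rootElement_eq_iff hγ).mp h
    · intro h
      have hβ : cs.IsRoot β := by
        rcases h with rfl | rfl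
        exacts [hγ, hγ.neg]
      exact ⟨hβ, (hβ.rootElement_eq_iff hγ).mpr h⟩
  have hne : γ ≠ -γ := fun h => hγ.ne_zero (self_eq_neg.mp h)
  rw [h, Finset.sum_pair hne, (hγ.neg.rootElement_eq_iff hγ).mpr (Or.inr rfl), two_mul]

/-- If every orbit of `c` on the roots meets `D` exactly once during one period, then sums of
`c`-invariant functions over all roots reduce to sums over `D`. -/
theorem sum_roots_eq_orderOf_mul {c : W} {D : Set (B → ℝ)} [DecidablePred (· ∈ D)]
    (hD : ∀ β, cs.IsRoot β →
      ((Finset.range (orderOf c)).filter fun k => cs.geomRep (c ^ k) β ∈ D).card = 1)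
    {F : (B → ℝ) → ℕ} (hF : ∀ w ∈ Subgroup.zpowers c, ∀ β, cs.IsRoot β → F (cs.geomRep w β) = F β) :
    ∑ β ∈ cs.roots, F β = orderOf c * ∑ β ∈ cs.roots.filter (· ∈ D), F β := by
  calc ∑ β ∈ cs.roots, F β = ∑ β ∈ cs.roots, ∑ k ∈ Finset.range (orderOf c),
        if cs.geomRep (c ^ k) β ∈ D then F β else 0 := by
        refine Finset.sum_congr rfl fun β hβ => ?_
        rw [← Finset.sum_filter, Finset.sum_const, hD β (cs.mem_roots.mp hβ), one_smul]
    _ = ∑ k ∈ Finset.range (orderOf c), ∑ β ∈ cs.roots.filter (· ∈ D), F β := by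
        rw [Finset.sum_comm]
        refine Finset.sum_congr rfl fun k _ => ?_
        rw [← Finset.sum_filter]
        refine Finset.sum_nbij' (cs.geomRep (c ^ k)) (cs.geomRep (c ^ k)⁻¹) ?_ ?_ ?_ ?_ ?_
        · intro β hβ
          simp only [Finset.mem_filter, mem_roots] at hβ ⊢
          exact ⟨hβ.1.geomRep _, hβ.2⟩
        · intro β hβ
          simp only [Finset.mem_filter, mem_roots, geomRep_apply_inv_self] at hβ ⊢
          exact ⟨hβ.1.geomRep _, hβ.2⟩
        · exact fun β _ => cs.geomRep_inv_apply_self _ _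
        · exact fun β _ => cs.geomRep_apply_inv_self _ _
        · intro β hβ
          simp only [Finset.mem_filter, mem_roots] at hβ
          exact (hF _ (Subgroup.npow_mem_zpowers c k) β hβ.1).symm
    _ = _ := by rw [Finset.sum_const, Finset.card_range, smul_eq_mul]

theorem exists_rootElement_wordRoot_mul {l : List B} (hl : l.Nodup) (hmem : ∀ i, i ∈ l) (j : B) :
    ∃ l' : List B, l'.Nodup ∧ (∀ i, i ∈ l' ↔ i ≠ j) ∧ l'.length + 1 = l.length ∧
      cs.rootElement (cs.wordRoot l j) * cs.wordProd l = cs.wordProd l' := by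
  obtain ⟨b, hb⟩ := exists_eq_takeWhile_append (hmem j)
  set a := l.takeWhile (· ≠ j) with ha
  have hperm : l.Perm (j :: (a ++ b)) := by
    rw [hb]
    exact List.perm_middle
  have hnd := List.nodup_cons.mp (hperm.nodup_iff.mp hl)
  refine ⟨a ++ b, hnd.2, fun i => ⟨?_, fun hi => ?_⟩, by rw [hperm.length_eq, List.length_cons], ?_⟩
  · rintro hi rfl
    exact hnd.1 hi
  · exact (List.mem_cons.mp (hperm.mem_iff.mp (hmem i))).resolve_left hi
  · rw [wordRoot, ← ha, rootElement_geomRep_simpleRoot]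
    rw [hb, wordProd_append, wordProd_append, wordProd_cons]
    simp only [mul_assoc, inv_mul_cancel_left, simple_mul_simple_cancel_left]

theorem absLength_mul_of_isReflectionOf {l : List B} (hl : l.Nodup) (hmem : ∀ i, i ∈ l)
    (hD : ∀ β, cs.IsRoot β → ∃ k, cs.geomRep (cs.wordProd l ^ k) β ∈ Set.range (cs.wordRoot l))
    {t : W} (ht : IsReflectionOf (simpleSet cs) t) :
    absLength (simpleSet cs) (t * cs.wordProd l) + 1 =
      absLength (simpleSet cs) (cs.wordProd l) := by
  obtain ⟨β, hβ, rfl⟩ := cs.exists_rootElement_eq ht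
  obtain ⟨k, j, hj⟩ := hD β hβ
  obtain ⟨l', hl', -, hlen, h⟩ := cs.exists_rootElement_wordRoot_mul hl hmem j
  rw [hj, hβ.rootElement_geomRep] at h
  set c := cs.wordProd l with hc
  have h1 : c ^ k * cs.rootElement β * (c ^ k)⁻¹ * c =
      c ^ k * (cs.rootElement β * c) * (c ^ k)⁻¹ := by
    have : (c ^ k)⁻¹ * c = c * (c ^ k)⁻¹ := ((Commute.refl c).pow_left k).inv_left.eq
    simp only [mul_assoc, this]
  rw [← cs.reflectionsGenerate.absLength_conj (c ^ k), ← h1, h,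
    cs.absLength_wordProd_of_nodup hl', hc, cs.absLength_wordProd_of_nodup hl, hlen]

theorem two_mul_edgeCount_wordProd {l : List B} (hl : l.Nodup) (hmem : ∀ i, i ∈ l)
    (hD : ∀ (D : Set (B → ℝ)) [DecidablePred (· ∈ D)],
      D = {β | cs.IsRoot β ∧ 0 ≤ β ∧ cs.geomRep (cs.wordProd l)⁻¹ β ≤ 0} → ∀ β, cs.IsRoot β →
        ((Finset.range (orderOf (cs.wordProd l))).filter
          fun k => cs.geomRep (cs.wordProd l ^ k) β ∈ D).card = 1)
    (c' : ∀ s, parabolic cs s) (hc' : ∀ s, IsCoxeterElementOf (parabolicGens cs s) (c' s)) :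
    2 * edgeCount (simpleSet cs) (cs.wordProd l) =
      orderOf (cs.wordProd l) * ∑ s : B, ncCount (parabolicGens cs s) (c' s) := by
  classical
  have : Fintype {t // IsReflectionOf (simpleSet cs) t} := Fintype.ofFinite _
  have hS := cs.reflectionsGenerate
  have hD := hD _ (cs.range_wordRoot hl hmem)
  have hsq (t : W) (ht : IsReflectionOf (simpleSet cs) t) : t * t = 1 := by
    obtain ⟨w, i, rfl⟩ := cs.isReflectionOf_iff.mp ht
    simp [mul_assoc]
  have hlen (t : W) (ht : IsReflectionOf (simpleSet cs) t) :=
    cs.absLength_mul_of_isReflectionOf hl hmem (fun β hβ => by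
      obtain ⟨k, hk⟩ := Finset.card_pos.mp (one_pos.trans_eq (hD β hβ).symm)
      exact ⟨k, (Finset.mem_filter.mp hk).2⟩) ht
  rw [hS.edgeCount_eq_sum hsq hlen,
    ← cs.sum_roots_rootElement fun t => ncCount (simpleSet cs) (t * cs.wordProd l),
    cs.sum_roots_eq_orderOf_mul hD
      (F := fun β => ncCount (simpleSet cs) (cs.rootElement β * cs.wordProd l))]
  · have himage : cs.roots.filter (· ∈ Set.range (cs.wordRoot l)) =
        Finset.univ.image (cs.wordRoot l) := by
      ext β
      simp only [Finset.mem_filter, mem_roots, Set.mem_range, Finset.mem_image, Finset.mem_univ,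
        true_and, and_iff_right_iff_imp]
      rintro ⟨j, rfl⟩
      exact cs.isRoot_wordRoot l j
    rw [himage, Finset.sum_image (cs.wordRoot_injective l).injOn]
    congr 1
    refine Finset.sum_congr rfl fun j _ => ?_
    obtain ⟨l', hl', hmem', -, h⟩ := cs.exists_rootElement_wordRoot_mul hl hmem j
    obtain ⟨l'', hl'', hmem'', h'⟩ := cs.exists_wordProd_of_isCoxeterElementOf_parabolic (hc' j)
    rw [h, cs.ncCount_parabolic (hc' j), ← h']
    exact hS.ncCount_eq_of_isConj (cs.isConj_wordProd_of_perm hl'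
      ((List.perm_ext_iff_of_nodup hl' hl'').mpr fun i => by rw [hmem', hmem'']))
  · intro w hw β hβ
    have h : w⁻¹ * cs.wordProd l = cs.wordProd l * w⁻¹ := by
      obtain ⟨k, rfl⟩ := Subgroup.mem_zpowers_iff.mp hw
      exact ((Commute.refl (cs.wordProd l)).zpow_left k).inv_left.eq
    rw [hβ.rootElement_geomRep, mul_assoc, h, ← mul_assoc, mul_assoc w, hS.ncCount_conj]

end CoxeterSystem

/-- **Corollary (recursion for the number of edges).**
If `(W,S)` is a finite irreducible Coxeter system with Coxeter number `h`, then
`2·E(W) = h · ∑_{s∈S} NC(W_⟨s⟩)`. -/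
theorem edge_count_recursion
    {B : Type} [Fintype B] {W : Type} [Group W] [Fintype W]
    {M : CoxeterMatrix B} (cs : CoxeterSystem M W)
    (hirr : IsIrreducibleCS cs)
    (c : W) (hc : IsCoxeterElementOf (simpleSet cs) c)
    (h : ℕ) (hh : h = orderOf c)
    (c' : ∀ s : B, parabolic cs s)
    (hc' : ∀ s : B, IsCoxeterElementOf (parabolicGens cs s) (c' s)) :
    2 * edgeCount (simpleSet cs) c =
      h * ∑ s : B, ncCount (parabolicGens cs s) (c' s) := by
  classical
  obtain ⟨f, hf⟩ := cs.exists_coloring_card_eq_one hirr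
  obtain ⟨l, hl, hmem, rfl⟩ := cs.exists_wordProd_of_isCoxeterElementOf (J := Set.univ) (c := c)
    (by rwa [Set.image_univ])
  obtain ⟨g, hg⟩ := isConj_iff.mp (cs.isConj_wordProd_of_perm (CoxeterSystem.nodup_bipartite f)
    ((List.perm_ext_iff_of_nodup (CoxeterSystem.nodup_bipartite f) hl).mpr fun i => by
      simp only [CoxeterSystem.mem_bipartite, hmem, Set.mem_univ]))
  rw [hh, ← hg, cs.reflectionsGenerate.edgeCount_conj, ← MulAut.conj_apply,
    MulEquiv.orderOf_eq]
  exact cs.two_mul_edgeCount_wordProd (CoxeterSystem.nodup_bipartite f)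
    (CoxeterSystem.mem_bipartite f) hf c' hc'
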